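/- arXiv:1912.02886 — 4 statements merged into one kernel-verified Lean document; each statement's English description precedes it below -/
import Mathlib

section
/- Let r and s be coprime positive integers with s even and r < s, and set p = r/s, assuming p ≠ 1/2 (so 0 < p < 1 and p ≠ 1/2). Then for every ε > 0 there exists N such that for every odd integer n ≥ N the following holds: if ℓ is an integer with n/2 ≤ ℓ ≤ n such that max_{y ∈ ℤ} D(ℓ, n−ℓ, p, y) ≥ max_{y ∈ ℤ} D(ℓ', n−ℓ', p, y) for every integer 0 ≤ ℓ' ≤ n, then |ℓ − (1/2 + 3/(5·|1−2p|·s))·n| ≤ ε·n. That is, for odd n the optimal number of +1 coefficients is (1/2 + 3/(5|1−2p|s) + o(1))·n. -/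
open Finset

/-- `D ℓ m p y` is the probability that `Bin(ℓ,p) - Bin(m,p) = y` for independent
binomials. -/
noncomputable def D (ℓ m : ℕ) (p : ℝ) (y : ℤ) : ℝ :=
  ∑ k ∈ Finset.range (ℓ + 1), ∑ j ∈ Finset.range (m + 1),
    if (k : ℤ) - (j : ℤ) = y then
      (ℓ.choose k : ℝ) * (m.choose j : ℝ) * p ^ (k + j) * (1 - p) ^ ((ℓ - k) + (m - j))
    else 0

/-- The squared modulus of the characteristic function `θ ↦ 1 - p + p * exp (i θ)` of a Bernoulli
variable. -/
noncomputable def charSq (p θ : ℝ) : ℝ := 1 - 2 * p * (1 - p) * (1 - Real.cos θ)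

/-- The normalised cubic correction to the argument of the Bernoulli characteristic function. -/
noncomputable def cubicPhase (p θ : ℝ) : ℝ :=
  ∫ s in (0 : ℝ)..1, s ^ 2 / 2 * Real.sinc (θ * s / 2) ^ 2 / charSq p (θ * s)

/-- A continuous branch of the argument of the Bernoulli characteristic function. -/
noncomputable def phase (p θ : ℝ) : ℝ :=
  p * θ - p * (1 - p) * (1 - 2 * p) * (θ ^ 3 * cubicPhase p θ)

lemma charSq_pos {p : ℝ} (hp0 : 0 ≤ p) (hp1 : p ≤ 1) (hp : p ≠ 1 / 2) (θ : ℝ) :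
    0 < charSq p θ := by
  have h1 : 0 < (1 - 2 * p) ^ 2 := by
    have : 1 - 2 * p ≠ 0 := fun h => hp (by linarith)
    positivity
  have h2 : 0 ≤ p * (1 - p) := mul_nonneg hp0 (by linarith)
  have h3 := Real.neg_one_le_cos θ
  unfold charSq
  nlinarith [mul_nonneg h2 (by linarith : 0 ≤ 1 + Real.cos θ)]

lemma continuous_charSq (p : ℝ) : Continuous (charSq p) := by
  unfold charSq
  fun_prop

lemma charSq_le_one {p : ℝ} (hp0 : 0 ≤ p) (hp1 : p ≤ 1) (θ : ℝ) : charSq p θ ≤ 1 := by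
  have h2 : 0 ≤ p * (1 - p) := mul_nonneg hp0 (by linarith)
  have h3 := Real.cos_le_one θ
  unfold charSq
  nlinarith [mul_nonneg h2 (by linarith : 0 ≤ 1 - Real.cos θ)]

lemma one_sub_cos_eq_sinc (u : ℝ) : 1 - Real.cos u = u ^ 2 / 2 * Real.sinc (u / 2) ^ 2 := by
  rcases eq_or_ne u 0 with rfl | hu
  · simp
  · rw [Real.sinc_of_ne_zero (by simpa using hu)]
    have h1 := Real.cos_two_mul (u / 2)
    have h2 := Real.sin_sq_add_cos_sq (u / 2)
    rw [show 2 * (u / 2) = u by ring] at h1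
    field_simp
    linarith

lemma continuous_cubicPhase {p : ℝ} (hp0 : 0 ≤ p) (hp1 : p ≤ 1) (hp : p ≠ 1 / 2) :
    Continuous (cubicPhase p) := by
  unfold cubicPhase
  apply intervalIntegral.continuous_parametric_intervalIntegral_of_continuous'
  have h := continuous_charSq p
  have h0 := fun θ => (charSq_pos hp0 hp1 hp θ).ne'
  have hs := Real.continuous_sinc
  unfold Function.uncurry
  exact Continuous.div (by fun_prop) (by fun_prop) (fun _ => h0 _)

lemma cubicPhase_zero (p : ℝ) : cubicPhase p 0 = 1 / 6 := by
  simp [cubicPhase, charSq]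
  norm_num

lemma pow_three_mul_cubicPhase (p θ : ℝ) :
    θ ^ 3 * cubicPhase p θ = ∫ x in (0 : ℝ)..θ, (1 - Real.cos x) / charSq p x := by
  have h := intervalIntegral.smul_integral_comp_mul_left (a := 0) (b := 1)
    (fun x => (1 - Real.cos x) / charSq p x) θ
  simp only [mul_zero, mul_one, smul_eq_mul] at h
  rw [← h, cubicPhase, ← intervalIntegral.integral_const_mul,
    ← intervalIntegral.integral_const_mul]
  congr 1
  ext s
  rw [one_sub_cos_eq_sinc]
  ring

lemma hasDerivAt_phase {p : ℝ} (hp0 : 0 ≤ p) (hp1 : p ≤ 1) (hp : p ≠ 1 / 2) (θ : ℝ) :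
    HasDerivAt (phase p)
      (p - p * (1 - p) * (1 - 2 * p) * ((1 - Real.cos θ) / charSq p θ)) θ := by
  have hc : Continuous fun x => (1 - Real.cos x) / charSq p x :=
    Continuous.div (by fun_prop) (continuous_charSq p)
      (fun x => (charSq_pos hp0 hp1 hp x).ne')
  have h := intervalIntegral.integral_hasDerivAt_right (hc.intervalIntegrable 0 θ)
    (hc.stronglyMeasurableAtFilter _ _) hc.continuousAt
  have h2 := ((hasDerivAt_id θ).const_mul p).sub (h.const_mul (p * (1 - p) * (1 - 2 * p)))
  simp only [mul_one] at h2
  refine h2.congr_of_eventuallyEq (Filter.Eventually.of_forall fun x => ?_)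
  simp [phase, pow_three_mul_cubicPhase]

lemma continuous_phase {p : ℝ} (hp0 : 0 ≤ p) (hp1 : p ≤ 1) (hp : p ≠ 1 / 2) :
    Continuous (phase p) :=
  continuous_iff_continuousAt.2 fun θ => (hasDerivAt_phase hp0 hp1 hp θ).continuousAt

open Complex in
lemma char_polar {p : ℝ} (hp0 : 0 ≤ p) (hp1 : p ≤ 1) (hp : p ≠ 1 / 2) (θ : ℝ) :
    (1 - p + p * exp (θ * I) : ℂ) = (√(charSq p θ) : ℝ) * exp (phase p θ * I) := by
  have hpos := charSq_pos hp0 hp1 hp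
  have hconst : ∀ x : ℝ, HasDerivAt
      (fun x : ℝ => (1 - p + p * exp (x * I) : ℂ) * exp (-(phase p x * I)) *
        (((√(charSq p x))⁻¹ : ℝ) : ℂ)) 0 x := by
    intro x
    have h1 : HasDerivAt (fun x : ℝ => (1 - p + p * exp (x * I) : ℂ))
        (p * (exp (x * I) * (1 * I))) x :=
      ((((hasDerivAt_id x).ofReal_comp.mul_const I).cexp).const_mul (p : ℂ)).const_add _
    have h2 := ((((hasDerivAt_phase hp0 hp1 hp x).ofReal_comp).mul_const I).neg).cexp
    have h3 : HasDerivAt (charSq p) (-(2 * p * (1 - p) * Real.sin x)) x := by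
      have := (((Real.hasDerivAt_cos x).const_sub 1).const_mul (2 * p * (1 - p))).const_sub 1
      convert! this using 1
      ring
    have h4 := ((h3.sqrt (hpos x).ne').inv (Real.sqrt_ne_zero'.2 (hpos x))).ofReal_comp
    have h5 := (h1.mul h2).mul h4
    convert! h5 using 1
    have hs : (√(charSq p x)) ≠ 0 := Real.sqrt_ne_zero'.2 (hpos x)
    have hsq : ((√(charSq p x) : ℝ) : ℂ) ^ 2 = 1 - 2 * p * (1 - p) * (1 - Complex.cos x) := by
      rw [← ofReal_pow, Real.sq_sqrt (hpos x).le, charSq]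
      push_cast
      ring
    have hs' : ((√(charSq p x) : ℝ) : ℂ) ≠ 0 := by exact_mod_cast hs
    have hcq : ((charSq p x : ℝ) : ℂ) = 1 - 2 * p * (1 - p) * (1 - Complex.cos x) := by
      rw [charSq]; push_cast; ring
    have hq' : (1 - 2 * p * (1 - p) * (1 - Complex.cos x) : ℂ) ≠ 0 := by
      rw [← hcq]; exact_mod_cast (hpos x).ne'
    simp only [Pi.mul_apply, Pi.neg_apply, Pi.inv_apply]
    push_cast
    rw [hsq, hcq, exp_mul_I]
    have hcs := Complex.sin_sq_add_cos_sq (x : ℂ)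
    generalize Complex.exp (-(phase p x * I)) = w
    generalize ((√(charSq p x) : ℝ) : ℂ) = σ at *
    generalize Complex.cos x = c at *
    generalize Complex.sin x = s at *
    have hI := I_sq
    have hq : (1 - p * (1 - p) * 2 * (1 - c) : ℂ) ≠ 0 := by
      convert! hq' using 1
      ring
    field_simp
    linear_combination
      -(p * w * (s * (1 - 2 * p * (1 - p) * (1 - c)) - p * s * (p + (1 - p) * c))) * hI -
        p * w * p * (1 - p) * I * hcs
  have h0 := is_const_of_deriv_eq_zero (fun x => (hconst x).differentiableAt)
    (fun x => (hconst x).deriv) θ 0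
  have hs' : ((√(charSq p θ) : ℝ) : ℂ) ≠ 0 := by
    exact_mod_cast Real.sqrt_ne_zero'.2 (hpos θ)
  have : (1 - p + p * exp (θ * I) : ℂ) * exp (-(phase p θ * I)) *
      ((√(charSq p θ) : ℝ) : ℂ)⁻¹ = 1 := by
    simpa [phase, charSq] using h0
  rw [exp_neg] at this
  field_simp at this
  rw [this, mul_comm, mul_comm I]

open Complex in
lemma integral_exp_int_mul (k : ℤ) :
    ∫ θ in (-Real.pi)..Real.pi, exp (k * θ * I) = if k = 0 then 2 * (Real.pi : ℂ) else 0 := by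
  split_ifs with h
  · simp [h]
    ring
  · have hk : (k : ℂ) * I ≠ 0 := mul_ne_zero (by exact_mod_cast h) I_ne_zero
    have h1 := integral_exp_mul_complex (a := -Real.pi) (b := Real.pi) hk
    have h2 : ∀ θ : ℝ, (k : ℂ) * θ * I = k * I * θ := fun θ => by ring
    simp_rw [h2]
    rw [h1, div_eq_zero_iff]
    left
    rw [sub_eq_zero, exp_eq_exp_iff_exists_int]
    exact ⟨k, by push_cast; ring⟩

open Complex in
lemma two_pi_mul_D (ℓ m : ℕ) (p : ℝ) (y : ℤ) :
    (2 * Real.pi * D ℓ m p y : ℂ) = ∫ θ in (-Real.pi)..Real.pi,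
      (1 - p + p * exp (θ * I) : ℂ) ^ ℓ * (1 - p + p * exp (-(θ * I)) : ℂ) ^ m *
        exp (-(y * θ * I)) := by
  have h : ∀ θ : ℝ, (1 - p + p * exp (θ * I) : ℂ) ^ ℓ * (1 - p + p * exp (-(θ * I)) : ℂ) ^ m *
        exp (-(y * θ * I)) = ∑ k ∈ Finset.range (ℓ + 1), ∑ j ∈ Finset.range (m + 1),
      ((ℓ.choose k : ℂ) * (m.choose j : ℂ) * p ^ (k + j) * (1 - p) ^ ((ℓ - k) + (m - j))) *
        exp (((k - j - y : ℤ) : ℂ) * θ * I) := by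
    intro θ
    rw [add_comm (1 - p : ℂ), add_pow, add_comm (1 - p : ℂ), add_pow, Finset.sum_mul_sum,
      Finset.sum_mul]
    refine Finset.sum_congr rfl fun k _ => ?_
    rw [Finset.sum_mul]
    refine Finset.sum_congr rfl fun j _ => ?_
    have : exp (((k - j - y : ℤ) : ℂ) * θ * I) =
        exp (θ * I) ^ k * exp (-(θ * I)) ^ j * exp (-(y * θ * I)) := by
      rw [← exp_nat_mul, ← exp_nat_mul, ← exp_add, ← exp_add]
      congr 1
      push_cast
      ring
    rw [this, mul_pow, mul_pow]
    ring
  simp_rw [h]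
  rw [intervalIntegral.integral_finsetSum fun k _ =>
    Continuous.intervalIntegrable (by fun_prop) _ _, D, ofReal_sum, Finset.mul_sum]
  refine Finset.sum_congr rfl fun k _ => ?_
  rw [intervalIntegral.integral_finsetSum fun k _ =>
    Continuous.intervalIntegrable (by fun_prop) _ _,
    ofReal_sum, Finset.mul_sum]
  refine Finset.sum_congr rfl fun j _ => ?_
  rw [intervalIntegral.integral_const_mul, integral_exp_int_mul]
  by_cases hk : (k : ℤ) - j = y
  · simp [hk]
    ring
  · simp [hk, sub_ne_zero.2 hk]

open Complex in
lemma two_pi_mul_D_eq_integral_cos {p : ℝ} (hp0 : 0 ≤ p) (hp1 : p ≤ 1) (hp : p ≠ 1 / 2)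
    (ℓ m : ℕ) (y : ℤ) :
    2 * Real.pi * D ℓ m p y = ∫ θ in (-Real.pi)..Real.pi,
      √(charSq p θ) ^ (ℓ + m) * Real.cos (((ℓ : ℝ) - m) * phase p θ - y * θ) := by
  have hcp := continuous_phase hp0 hp1 hp
  have hcs := continuous_charSq p
  have h := two_pi_mul_D ℓ m p y
  have h1 : ∀ θ : ℝ, (1 - p + p * exp (θ * I) : ℂ) ^ ℓ * (1 - p + p * exp (-(θ * I)) : ℂ) ^ m *
        exp (-(y * θ * I)) = ((√(charSq p θ) ^ (ℓ + m) : ℝ) : ℂ) *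
          exp ((((ℓ : ℝ) - m) * phase p θ - y * θ : ℝ) * I) := by
    intro θ
    have hz := char_polar hp0 hp1 hp θ
    have hz' : (1 - p + p * exp (-(θ * I)) : ℂ) =
        (√(charSq p θ) : ℝ) * exp (-(phase p θ * I)) := by
      have := congrArg (starRingEnd ℂ) hz
      simpa [← exp_conj] using this
    rw [hz, hz', mul_pow, mul_pow, ← exp_nat_mul, ← exp_nat_mul]
    have : exp ((((ℓ : ℝ) - m) * phase p θ - y * θ : ℝ) * I) =
        exp (ℓ * (phase p θ * I)) * exp (m * -(phase p θ * I)) * exp (-(y * θ * I)) := by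
      rw [← exp_add, ← exp_add]
      congr 1
      push_cast
      ring
    rw [this]
    push_cast
    ring
  simp_rw [h1] at h
  have h2 := congrArg Complex.re h
  have h3 := reCLM.intervalIntegral_comp_comm (μ := MeasureTheory.volume)
    (a := -Real.pi) (b := Real.pi)
    (f := fun θ : ℝ => ((√(charSq p θ) ^ (ℓ + m) : ℝ) : ℂ) *
          exp ((((ℓ : ℝ) - m) * phase p θ - y * θ : ℝ) * I))
    (Continuous.intervalIntegrable (by fun_prop) _ _)
  simp only [reCLM_apply, re_ofReal_mul, exp_ofReal_mul_I_re] at h3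
  rw [h3, ← h2]
  norm_cast

/-- The loss of the point probability relative to perfect phase alignment, for `n` summands with
sign imbalance `d` at distance `b` below the mean. -/
noncomputable def deficit (p : ℝ) (n : ℕ) (d b : ℝ) : ℝ :=
  ∫ θ in (-Real.pi)..Real.pi, √(charSq p θ) ^ n *
    (1 - Real.cos (b * θ - d * (p * (1 - p) * (1 - 2 * p)) * (θ ^ 3 * cubicPhase p θ)))

lemma two_pi_mul_D_eq_sub_deficit {p : ℝ} (hp0 : 0 ≤ p) (hp1 : p ≤ 1) (hp : p ≠ 1 / 2)
    {n ℓ : ℕ} (hℓ : ℓ ≤ n) (y : ℤ) :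
    2 * Real.pi * D ℓ (n - ℓ) p y = (∫ θ in (-Real.pi)..Real.pi, √(charSq p θ) ^ n) -
      deficit p n (2 * ℓ - n) ((2 * ℓ - n) * p - y) := by
  have hcs := continuous_charSq p
  have hc := continuous_cubicPhase hp0 hp1 hp
  rw [two_pi_mul_D_eq_integral_cos hp0 hp1 hp, deficit,
    ← intervalIntegral.integral_sub (Continuous.intervalIntegrable (by fun_prop) _ _)
      (Continuous.intervalIntegrable (by fun_prop) _ _)]
  congr 1
  ext θ
  rw [Nat.add_sub_of_le hℓ, Nat.cast_sub hℓ, phase]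
  ring_nf

lemma integrable_pow_mul_exp_neg_mul_sq {c : ℝ} (hc : 0 < c) (k : ℕ) :
    MeasureTheory.Integrable fun x : ℝ => x ^ k * Real.exp (-c * x ^ 2) := by
  have := integrable_rpow_mul_exp_neg_mul_sq hc (s := k)
    (by have : (0 : ℝ) ≤ k := k.cast_nonneg
        linarith)
  simpa using this

lemma sqrt_charSq_pow_le {p : ℝ} (hp0 : 0 ≤ p) (hp1 : p ≤ 1) (n : ℕ) {θ : ℝ}
    (hθ : |θ| ≤ Real.pi) :
    √(charSq p θ) ^ n ≤ Real.exp (-(2 * (p * (1 - p)) / Real.pi ^ 2) * (n * θ ^ 2)) := by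
  have h2 : 0 ≤ p * (1 - p) := mul_nonneg hp0 (by linarith)
  have h1 : charSq p θ ≤ Real.exp (-(4 * (p * (1 - p)) / Real.pi ^ 2 * θ ^ 2)) := by
    refine le_trans ?_ (Real.one_sub_le_exp_neg _)
    have h3 := Real.cos_le_one_sub_mul_cos_sq hθ
    have h4 := mul_le_mul_of_nonneg_left h3 (mul_nonneg zero_le_two h2)
    unfold charSq
    calc _ = 1 - 2 * (p * (1 - p)) + 2 * (p * (1 - p)) * Real.cos θ := by ring
      _ ≤ 1 - 2 * (p * (1 - p)) + 2 * (p * (1 - p)) * (1 - 2 / Real.pi ^ 2 * θ ^ 2) := by linarith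
      _ = _ := by ring
  calc √(charSq p θ) ^ n ≤ √(Real.exp (-(4 * (p * (1 - p)) / Real.pi ^ 2 * θ ^ 2))) ^ n := by
        gcongr
    _ = _ := by
        rw [← Real.exp_half, ← Real.exp_nat_mul]
        congr 1
        ring

lemma tendsto_div_sqrt_natCast (x : ℝ) :
    Filter.Tendsto (fun n : ℕ => x / √n) Filter.atTop (nhds 0) :=
  Filter.Tendsto.const_div_atTop
    (Real.tendsto_sqrt_atTop.comp tendsto_natCast_atTop_atTop) x

lemma tendsto_sqrt_charSq_pow {p : ℝ} (hp0 : 0 ≤ p) (hp1 : p ≤ 1) (hp : p ≠ 1 / 2) (x : ℝ) :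
    Filter.Tendsto (fun n : ℕ => √(charSq p (x / √n)) ^ n) Filter.atTop
      (nhds (Real.exp (-(p * (1 - p) / 2) * x ^ 2))) := by
  have hx := tendsto_div_sqrt_natCast x
  have hg : Filter.Tendsto
      (fun n : ℕ => (n : ℝ) * -(2 * p * (1 - p) * (1 - Real.cos (x / √n)))) Filter.atTop
      (nhds (-(p * (1 - p)) * x ^ 2)) := by
    have h1 : Filter.Tendsto
        (fun n : ℕ => -(p * (1 - p)) * x ^ 2 * Real.sinc (x / √n / 2) ^ 2) Filter.atTop
        (nhds (-(p * (1 - p)) * x ^ 2)) := by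
      have h2 := ((Real.continuous_sinc.tendsto _).comp (hx.div_const 2)).pow 2
      have h3 := h2.const_mul (-(p * (1 - p)) * x ^ 2)
      simpa using h3
    refine h1.congr' ?_
    filter_upwards [Filter.eventually_gt_atTop 0] with n hn
    have hn' : (0 : ℝ) < n := by exact_mod_cast hn
    rw [one_sub_cos_eq_sinc, div_pow x, Real.sq_sqrt hn'.le]
    field_simp
  have h := (Real.tendsto_one_add_pow_exp_of_tendsto hg).sqrt
  rw [← Real.exp_half] at h
  convert! h using 2 with n
  · have hpos := (charSq_pos hp0 hp1 hp (x / √n)).le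
    rw [eq_comm, Real.sqrt_eq_iff_eq_sq, ← pow_mul, mul_comm n 2, pow_mul, Real.sq_sqrt hpos]
    · simp [charSq, sub_eq_add_neg]
    · have : 0 ≤ charSq p (x / √n) ^ n := by positivity
      simpa [charSq, sub_eq_add_neg] using this
    · positivity
  · congr 1
    ring

lemma sqrt_pow_three_mul_deficit (p : ℝ) (n : ℕ) (d b : ℝ) :
    √n ^ 3 * deficit p n d b = ∫ x : ℝ, (Set.Ioc (-Real.pi) Real.pi).indicator
      (fun θ => n * (√(charSq p θ) ^ n *
        (1 - Real.cos (b * θ - d * (p * (1 - p) * (1 - 2 * p)) * (θ ^ 3 * cubicPhase p θ)))))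
      (x / √n) := by
  have hn' : (0 : ℝ) ≤ n := n.cast_nonneg
  rw [MeasureTheory.Measure.integral_comp_div, MeasureTheory.integral_indicator measurableSet_Ioc,
    MeasureTheory.integral_const_mul, deficit,
    intervalIntegral.integral_of_le (by linarith [Real.pi_pos]), abs_of_nonneg (Real.sqrt_nonneg _),
    smul_eq_mul, pow_succ, Real.sq_sqrt hn']
  ring

lemma tendsto_deficit {p : ℝ} (hp0 : 0 < p) (hp1 : p < 1) (hp : p ≠ 1 / 2) {n : ℕ → ℕ}
    (hn : Filter.Tendsto n Filter.atTop Filter.atTop) (hn0 : ∀ j, 0 < n j) {d b : ℕ → ℝ}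
    {t β : ℝ} (hdn : ∀ j, |d j| ≤ n j)
    (hd : Filter.Tendsto (fun j => d j / n j) Filter.atTop (nhds t))
    (hb : Filter.Tendsto b Filter.atTop (nhds β)) :
    Filter.Tendsto (fun j => √(n j) ^ 3 * deficit p (n j) (d j) (b j)) Filter.atTop
      (nhds (∫ x : ℝ, Real.exp (-(p * (1 - p) / 2) * x ^ 2) *
        ((β * x - t * (p * (1 - p) * (1 - 2 * p)) * (x ^ 3 * (1 / 6))) ^ 2 / 2))) := by
  have hcs := continuous_charSq p
  have hcc := continuous_cubicPhase hp0.le hp1.le hp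
  have hpq : 0 < p * (1 - p) := mul_pos hp0 (by linarith)
  have hκ : (p * (1 - p) * (1 - 2 * p)) ^ 2 ≤ 1 := by
    have h1 : p * (1 - p) ≤ 1 := by nlinarith
    have h2 : (1 - 2 * p) ^ 2 ≤ 1 := by nlinarith
    calc _ = (p * (1 - p)) ^ 2 * (1 - 2 * p) ^ 2 := by ring
      _ ≤ 1 * 1 := by gcongr; nlinarith
      _ = 1 := by norm_num
  set κ := p * (1 - p) * (1 - 2 * p) with hκ'
  obtain ⟨B, hB⟩ := hb.abs.bddAbove_range
  obtain ⟨C, hC⟩ := (isCompact_Icc (a := -Real.pi) (b := Real.pi)).exists_bound_of_continuousOn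
    hcc.continuousOn
  set c := 2 * (p * (1 - p)) / Real.pi ^ 2 with hc
  have hc0 : 0 < c := by have := Real.pi_pos; positivity
  simp_rw [fun j => sqrt_pow_three_mul_deficit p (n j) (d j) (b j)]
  refine MeasureTheory.tendsto_integral_of_dominated_convergence
    (fun x => B ^ 2 * (x ^ 2 * Real.exp (-c * x ^ 2)) + C ^ 2 * (x ^ 6 * Real.exp (-c * x ^ 2)))
    ?_ ?_ ?_ ?_
  · intro j
    refine Measurable.aestronglyMeasurable ?_
    refine (Measurable.indicator (Continuous.measurable ?_) measurableSet_Ioc).comp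
      (measurable_id.div_const _)
    fun_prop
  · exact ((integrable_pow_mul_exp_neg_mul_sq hc0 2).const_mul _).add
      ((integrable_pow_mul_exp_neg_mul_sq hc0 6).const_mul _)
  · refine fun j => Filter.Eventually.of_forall fun x => ?_
    have hnj : (0 : ℝ) < n j := by exact_mod_cast hn0 j
    by_cases hx : x / √(n j) ∈ Set.Ioc (-Real.pi) Real.pi
    · rw [Set.indicator_of_mem hx]
      have hxθ : x ^ 2 = n j * (x / √(n j)) ^ 2 := by
        rw [div_pow, Real.sq_sqrt hnj.le]
        field_simp
      generalize x / √(n j) = θ at hx hxθ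
      have hθ : |θ| ≤ Real.pi := abs_le.2 ⟨hx.1.le, hx.2⟩
      have h1 := sqrt_charSq_pow_le hp0.le hp1.le (n j) hθ
      rw [← hxθ, ← hc] at h1
      have h2 : |b j| ≤ B := hB ⟨j, rfl⟩
      have h3 : |cubicPhase p θ| ≤ C := hC θ ⟨hx.1.le, hx.2⟩
      have h4 := Real.one_sub_sq_div_two_le_cos
        (x := b j * θ - d j * κ * (θ ^ 3 * cubicPhase p θ))
      have h5 := Real.cos_le_one (b j * θ - d j * κ * (θ ^ 3 * cubicPhase p θ))
      have h2' : b j ^ 2 ≤ B ^ 2 := sq_le_sq' (abs_le.1 h2).1 (abs_le.1 h2).2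
      have h3' : cubicPhase p θ ^ 2 ≤ C ^ 2 := sq_le_sq' (abs_le.1 h3).1 (abs_le.1 h3).2
      have h6' : d j ^ 2 ≤ (n j : ℝ) ^ 2 :=
        sq_le_sq' (abs_le.1 (hdn j)).1 (abs_le.1 (hdn j)).2
      have h7 : n j * (1 - Real.cos (b j * θ - d j * κ * (θ ^ 3 * cubicPhase p θ))) ≤
          B ^ 2 * x ^ 2 + C ^ 2 * x ^ 6 := by
        calc _ ≤ n j * ((b j * θ - d j * κ * (θ ^ 3 * cubicPhase p θ)) ^ 2 / 2) := by
              gcongr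
              linarith
          _ ≤ n j * ((b j * θ) ^ 2 + (d j * κ * (θ ^ 3 * cubicPhase p θ)) ^ 2) := by
              gcongr
              nlinarith [sq_nonneg (b j * θ + d j * κ * (θ ^ 3 * cubicPhase p θ))]
          _ = b j ^ 2 * (n j * θ ^ 2) +
              cubicPhase p θ ^ 2 * (n j * (d j ^ 2 * κ ^ 2) * θ ^ 6) := by ring
          _ ≤ B ^ 2 * (n j * θ ^ 2) + C ^ 2 * (n j * ((n j : ℝ) ^ 2 * 1) * θ ^ 6) := by gcongr
          _ = B ^ 2 * x ^ 2 + C ^ 2 * x ^ 6 := by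
              rw [show x ^ 6 = (x ^ 2) ^ 3 by ring, hxθ]
              ring
      rw [Real.norm_eq_abs, abs_of_nonneg (by have := sub_nonneg.2 h5; positivity)]
      calc _ = √(charSq p θ) ^ n j *
            (n j * (1 - Real.cos (b j * θ - d j * κ * (θ ^ 3 * cubicPhase p θ)))) := by ring
        _ ≤ Real.exp (-c * x ^ 2) * (B ^ 2 * x ^ 2 + C ^ 2 * x ^ 6) := by
            have := sub_nonneg.2 h5
            gcongr
        _ = _ := by ring
    · rw [Set.indicator_of_notMem hx, norm_zero]
      positivity
  · refine Filter.Eventually.of_forall fun x => ?_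
    have hθ : Filter.Tendsto (fun j => x / √(n j)) Filter.atTop (nhds 0) :=
      (tendsto_div_sqrt_natCast x).comp hn
    have hcub : Filter.Tendsto (fun j => cubicPhase p (x / √(n j))) Filter.atTop
        (nhds (1 / 6)) := by
      have := (hcc.tendsto 0).comp hθ
      rwa [cubicPhase_zero] at this
    have hv := (hb.mul_const x).sub ((hd.mul_const κ).mul (hcub.const_mul (x ^ 3)))
    have hinv : Filter.Tendsto (fun j => 1 / √(n j)) Filter.atTop (nhds 0) :=
      (tendsto_div_sqrt_natCast 1).comp hn
    have hu := (hv.mul hinv).div_const 2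
    rw [mul_zero, zero_div] at hu
    have hs := ((Real.continuous_sinc.tendsto _).comp hu).pow 2
    rw [Real.sinc_zero, one_pow] at hs
    have hW := (tendsto_sqrt_charSq_pow hp0.le hp1.le hp x).comp hn
    have hall := hW.mul (((hv.pow 2).div_const 2).mul hs)
    rw [mul_one] at hall
    refine hall.congr' ?_
    filter_upwards [hθ.eventually (Ioo_mem_nhds (neg_lt_zero.2 Real.pi_pos) Real.pi_pos)]
      with j hj
    have hnj : (0 : ℝ) < n j := by exact_mod_cast hn0 j
    have hsn : 0 < √(n j : ℝ) := Real.sqrt_pos.2 hnj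
    rw [Set.indicator_of_mem (Set.Ioo_subset_Ioc_self hj), one_sub_cos_eq_sinc]
    have key : b j * (x / √(n j)) - d j * κ * ((x / √(n j)) ^ 3 * cubicPhase p (x / √(n j))) =
        (b j * x - d j / n j * κ * (x ^ 3 * cubicPhase p (x / √(n j)))) * (1 / √(n j)) := by
      rw [div_pow, pow_succ (√(n j : ℝ)), Real.sq_sqrt hnj.le]
      field_simp
    rw [key, mul_pow _ (1 / √(n j : ℝ)), div_pow 1, Real.sq_sqrt hnj.le]
    simp only [Function.comp]
    field_simp

lemma integral_pow_add_two_mul_exp_neg_sq {a : ℝ} (ha : 0 < a) (k : ℕ) :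
    ∫ x : ℝ, x ^ (k + 2) * Real.exp (-(a / 2) * x ^ 2) =
      (k + 1) / a * ∫ x : ℝ, x ^ k * Real.exp (-(a / 2) * x ^ 2) := by
  have ha2 : 0 < a / 2 := by positivity
  have hi := integrable_pow_mul_exp_neg_mul_sq ha2
  have h := MeasureTheory.integral_eq_zero_of_hasDerivAt_of_integrable
    (f := fun x : ℝ => x ^ (k + 1) * Real.exp (-(a / 2) * x ^ 2))
    (f' := fun x : ℝ => (k + 1) * (x ^ k * Real.exp (-(a / 2) * x ^ 2)) -
      a * (x ^ (k + 2) * Real.exp (-(a / 2) * x ^ 2))) (fun x => ?_)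
    (((hi k).const_mul _).sub ((hi (k + 2)).const_mul _)) (hi (k + 1))
  · rw [MeasureTheory.integral_sub ((hi k).const_mul _) ((hi (k + 2)).const_mul _),
      MeasureTheory.integral_const_mul, MeasureTheory.integral_const_mul] at h
    rw [div_mul_eq_mul_div, eq_div_iff ha.ne']
    linarith
  · convert! (hasDerivAt_pow (k + 1) x).mul
      (((hasDerivAt_pow 2 x).const_mul (-(a / 2))).exp) using 1
    simp
    ring

lemma integral_gaussian_mul_cubic_sq {a : ℝ} (ha : 0 < a) (β A : ℝ) :
    ∫ x : ℝ, Real.exp (-(a / 2) * x ^ 2) * ((β * x - a * A * (x ^ 3 * (1 / 6))) ^ 2 / 2) =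
      (∫ x : ℝ, x ^ 2 * Real.exp (-(a / 2) * x ^ 2)) / 2 *
        (β ^ 2 - β * A + 5 / 12 * A ^ 2) := by
  have hi := integrable_pow_mul_exp_neg_mul_sq (by positivity : 0 < a / 2)
  have h4 := integral_pow_add_two_mul_exp_neg_sq ha 2
  have h6 := integral_pow_add_two_mul_exp_neg_sq ha 4
  simp only [Nat.reduceAdd] at h4 h6
  calc _ = ∫ x : ℝ, (β ^ 2 / 2 * (x ^ 2 * Real.exp (-(a / 2) * x ^ 2)) -
        β * a * A / 6 * (x ^ 4 * Real.exp (-(a / 2) * x ^ 2)) +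
        (a * A) ^ 2 / 72 * (x ^ 6 * Real.exp (-(a / 2) * x ^ 2))) := by
        congr 1
        ext x
        ring
    _ = _ := by
        have h24 : MeasureTheory.Integrable fun x : ℝ =>
            β ^ 2 / 2 * (x ^ 2 * Real.exp (-(a / 2) * x ^ 2)) -
              β * a * A / 6 * (x ^ 4 * Real.exp (-(a / 2) * x ^ 2)) :=
          ((hi 2).const_mul _).sub ((hi 4).const_mul _)
        rw [MeasureTheory.integral_add h24 ((hi 6).const_mul _),
          MeasureTheory.integral_sub ((hi 2).const_mul _) ((hi 4).const_mul _),
          MeasureTheory.integral_const_mul, MeasureTheory.integral_const_mul,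
          MeasureTheory.integral_const_mul, h6, h4]
        generalize ∫ x : ℝ, x ^ 2 * Real.exp (-(a / 2) * x ^ 2) = M
        push_cast
        field_simp
        ring

lemma integral_sq_mul_exp_neg_sq_pos {a : ℝ} (ha : 0 < a) :
    0 < ∫ x : ℝ, x ^ 2 * Real.exp (-(a / 2) * x ^ 2) := by
  have h2 := integral_pow_add_two_mul_exp_neg_sq ha 0
  simp only [zero_add, pow_zero, one_mul] at h2
  rw [h2, integral_gaussian]
  have := Real.pi_pos
  positivity

lemma sinc_le_one_sub_sq {x : ℝ} (hx : |x| ≤ Real.pi) :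
    Real.sinc x ≤ 1 - x ^ 2 / (2 * Real.pi ^ 2) := by
  have hπ := Real.pi_pos
  have hx' := abs_le.1 hx
  have h1 : Real.sinc x = Real.sinc (x / 2) * Real.cos (x / 2) := by
    rcases eq_or_ne x 0 with rfl | h0
    · simp
    · rw [Real.sinc_of_ne_zero h0, Real.sinc_of_ne_zero (by simpa using h0)]
      have := Real.sin_two_mul (x / 2)
      rw [show 2 * (x / 2) = x by ring] at this
      rw [this]
      field_simp
  have h2 : 0 ≤ Real.cos (x / 2) :=
    Real.cos_nonneg_of_mem_Icc ⟨by linarith, by linarith⟩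
  have h3 := Real.cos_le_one_sub_mul_cos_sq (x := x / 2)
    (by rw [abs_div, abs_two]; linarith [abs_nonneg x])
  calc _ ≤ 1 * Real.cos (x / 2) := by
        rw [h1]
        gcongr
        exact Real.sinc_le_one _
    _ ≤ 1 - 2 / Real.pi ^ 2 * (x / 2) ^ 2 := by linarith
    _ = _ := by ring

lemma min_le_mul_one_sub_sinc {n : ℕ} (hn : 0 < n) (b : ℝ) :
    min (b ^ 2 / (2 * Real.pi ^ 2)) ((n : ℝ) / 2) ≤ n * (1 - Real.sinc (b * (1 / √n))) := by
  have hn' : (0 : ℝ) < n := by exact_mod_cast hn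
  have hπ := Real.pi_gt_three
  rcases le_total |b * (1 / √n)| Real.pi with h | h
  · refine (min_le_left _ _).trans ?_
    have h1 := sinc_le_one_sub_sq h
    calc _ = n * ((b * (1 / √n)) ^ 2 / (2 * Real.pi ^ 2)) := by
          rw [mul_pow, div_pow, Real.sq_sqrt hn'.le]
          field_simp
      _ ≤ _ := by
          gcongr
          linarith
  · refine (min_le_right _ _).trans ?_
    generalize b * (1 / √n) = x at h
    have hx : x ≠ 0 := by
      rintro rfl
      rw [abs_zero] at h
      linarith
    have h1 : Real.sinc x ≤ 1 / 2 := by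
      rw [Real.sinc_of_ne_zero hx]
      refine (le_abs_self _).trans ?_
      rw [abs_div, div_le_iff₀ (by positivity)]
      linarith [Real.abs_sin_le_one x]
    nlinarith

lemma integral_cos_mul_eq_sinc (b h : ℝ) :
    ∫ θ in (-h)..h, Real.cos (b * θ) = 2 * h * Real.sinc (b * h) := by
  rcases eq_or_ne b 0 with rfl | hb
  · simp
    ring
  rcases eq_or_ne h 0 with rfl | hh
  · simp
  rw [intervalIntegral.integral_comp_mul_left _ hb, integral_cos,
    Real.sinc_of_ne_zero (mul_ne_zero hb hh), mul_neg, Real.sin_neg, smul_eq_mul]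
  field_simp
  ring

lemma three_quarters_le_sqrt_charSq_pow {p : ℝ} (hp0 : 0 ≤ p) (hp1 : p ≤ 1) {n : ℕ} (hn : 0 < n)
    {θ : ℝ} (hθ : n * θ ^ 2 ≤ 1) : 3 / 4 ≤ √(charSq p θ) ^ n := by
  have hn' : (1 : ℝ) ≤ n := by exact_mod_cast hn
  have h1 : 1 - θ ^ 2 / 4 ≤ charSq p θ := by
    have h2 : 0 ≤ p * (1 - p) := mul_nonneg hp0 (by linarith)
    have h3 := Real.one_sub_sq_div_two_le_cos (x := θ)
    have h4 : p * (1 - p) ≤ 1 / 4 := by nlinarith [sq_nonneg (p - 1 / 2)]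
    unfold charSq
    nlinarith [mul_le_mul_of_nonneg_left h3 h2, sq_nonneg θ]
  have hθ1 : θ ^ 2 ≤ 1 := by nlinarith [sq_nonneg θ]
  have h5 : charSq p θ ≤ √(charSq p θ) :=
    Real.le_sqrt_of_sq_le (by nlinarith [charSq_le_one hp0 hp1 θ])
  calc 3 / 4 ≤ 1 + n * (-(θ ^ 2 / 4)) := by linarith
    _ ≤ (1 + -(θ ^ 2 / 4)) ^ n := one_add_mul_le_pow (by linarith) n
    _ ≤ _ := by
      gcongr
      · linarith
      · linarith

lemma one_sub_cos_add_le (u g : ℝ) :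
    1 - Real.cos (u + g) ≤ 2 * (1 - Real.cos u) + g ^ 2 := by
  have h := Real.one_sub_sq_div_two_le_cos (x := g)
  have h1 := Real.sin_sq_add_cos_sq u
  have h2 := Real.sin_sq_add_cos_sq g
  rw [Real.cos_add]
  nlinarith [sq_nonneg (Real.cos u + Real.cos g - 2), sq_nonneg (Real.sin u - Real.sin g)]

lemma exists_le_sqrt_pow_three_mul_deficit {p : ℝ} (hp0 : 0 ≤ p) (hp1 : p ≤ 1)
    (hp : p ≠ 1 / 2) :
    ∃ C : ℝ, ∀ n : ℕ, 0 < n → ∀ d b : ℝ, |d| ≤ n →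
      3 / 4 * (n * (1 - Real.sinc (b * (1 / √n))) - C) ≤ √n ^ 3 * deficit p n d b := by
  have hcs := continuous_charSq p
  have hcc := continuous_cubicPhase hp0 hp1 hp
  obtain ⟨C, hC⟩ := (isCompact_Icc (a := -Real.pi) (b := Real.pi)).exists_bound_of_continuousOn
    hcc.continuousOn
  have hκ : (p * (1 - p) * (1 - 2 * p)) ^ 2 ≤ 1 := by
    have h0 : 0 ≤ p * (1 - p) := mul_nonneg hp0 (by linarith)
    have h1 : p * (1 - p) ≤ 1 := by nlinarith
    have h2 : (1 - 2 * p) ^ 2 ≤ 1 := by nlinarith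
    calc _ = (p * (1 - p)) ^ 2 * (1 - 2 * p) ^ 2 := by ring
      _ ≤ 1 * 1 := by gcongr; nlinarith
      _ = 1 := by norm_num
  refine ⟨C ^ 2, fun n hn d b hd => ?_⟩
  have hn' : (1 : ℝ) ≤ n := by exact_mod_cast hn
  have hπ := Real.pi_gt_three
  unfold deficit
  set κ := p * (1 - p) * (1 - 2 * p) with hκ'
  set h := 1 / √(n : ℝ) with hh
  have hsn : 1 ≤ √(n : ℝ) := Real.one_le_sqrt.2 hn'
  have hh0 : 0 < h := by positivity
  have hh1 : h ≤ 1 := by rw [hh, div_le_one (by positivity)]; exact hsn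
  have hhn : n * h ^ 2 = 1 := by
    rw [hh, div_pow, Real.sq_sqrt (by positivity)]
    field_simp
  have hmono : ∫ θ in (-h)..h, 3 / 4 * ((1 - Real.cos (b * θ)) / 2 - C ^ 2 * h ^ 2 / 2) ≤
      ∫ θ in (-Real.pi)..Real.pi, √(charSq p θ) ^ n *
        (1 - Real.cos (b * θ - d * κ * (θ ^ 3 * cubicPhase p θ))) := by
    refine le_trans (intervalIntegral.integral_mono_on (by linarith)
      (g := fun θ => √(charSq p θ) ^ n *
        (1 - Real.cos (b * θ - d * κ * (θ ^ 3 * cubicPhase p θ))))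
      (Continuous.intervalIntegrable (by fun_prop) _ _)
      (Continuous.intervalIntegrable (by fun_prop) _ _) ?_)
      (intervalIntegral.integral_mono_interval (by linarith) (by linarith) (by linarith)
        (Filter.Eventually.of_forall fun θ => ?_)
        (Continuous.intervalIntegrable (by fun_prop) _ _))
    · intro θ hθ
      have hθ2 : θ ^ 2 ≤ h ^ 2 := sq_le_sq' hθ.1 hθ.2
      have hw : 3 / 4 ≤ √(charSq p θ) ^ n :=
        three_quarters_le_sqrt_charSq_pow hp0 hp1 hn (by rw [← hhn]; gcongr)
      have hcos := one_sub_cos_add_le (b * θ - d * κ * (θ ^ 3 * cubicPhase p θ))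
        (d * κ * (θ ^ 3 * cubicPhase p θ))
      rw [sub_add_cancel] at hcos
      have h3 : |cubicPhase p θ| ≤ C := hC θ ⟨by linarith [hθ.1], by linarith [hθ.2]⟩
      have h3' : cubicPhase p θ ^ 2 ≤ C ^ 2 := sq_le_sq' (abs_le.1 h3).1 (abs_le.1 h3).2
      have hd' : d ^ 2 ≤ (n : ℝ) ^ 2 := sq_le_sq' (abs_le.1 hd).1 (abs_le.1 hd).2
      have hg : (d * κ * (θ ^ 3 * cubicPhase p θ)) ^ 2 ≤ C ^ 2 * h ^ 2 := by
        calc _ = d ^ 2 * κ ^ 2 * ((θ ^ 2) ^ 3 * cubicPhase p θ ^ 2) := by ring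
          _ ≤ (n : ℝ) ^ 2 * 1 * ((h ^ 2) ^ 3 * C ^ 2) := by gcongr
          _ = (n * h ^ 2) ^ 2 * (C ^ 2 * h ^ 2) := by ring
          _ = _ := by rw [hhn, one_pow, one_mul]
      have hpos := sub_nonneg.2
        (Real.cos_le_one (b * θ - d * κ * (θ ^ 3 * cubicPhase p θ)))
      calc _ ≤ 3 / 4 * (1 - Real.cos (b * θ - d * κ * (θ ^ 3 * cubicPhase p θ))) := by linarith
        _ ≤ _ := by gcongr
    · exact mul_nonneg (by positivity) (sub_nonneg.2 (Real.cos_le_one _))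
  rw [intervalIntegral.integral_const_mul, intervalIntegral.integral_sub
    (Continuous.intervalIntegrable (by fun_prop) _ _)
    (Continuous.intervalIntegrable (by fun_prop) _ _), intervalIntegral.integral_div,
    intervalIntegral.integral_sub
    (Continuous.intervalIntegrable (by fun_prop) _ _)
    (Continuous.intervalIntegrable (by fun_prop) _ _), integral_cos_mul_eq_sinc,
    intervalIntegral.integral_const, intervalIntegral.integral_const, smul_eq_mul,
    smul_eq_mul] at hmono
  refine le_trans (le_of_eq ?_) (mul_le_mul_of_nonneg_left hmono (by positivity))
  have hsh : √(n : ℝ) * h = 1 := by rw [hh]; field_simp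
  have hs2 : √(n : ℝ) ^ 2 = n := Real.sq_sqrt (by positivity)
  have hs3 : √(n : ℝ) ^ 3 * h = n := by rw [pow_succ, mul_assoc, hsh, hs2, mul_one]
  linear_combination (3 / 4) * (-(1 - Real.sinc (b * h)) + C ^ 2 * h ^ 2) * hs3 +
    (3 / 4) * C ^ 2 * hhn

lemma exists_near_optimal_imbalance {r s : ℕ} (hs : 0 < s) (hco : Nat.Coprime r s)
    (hse : Even s) {e : ℤ} (he : Odd e) {t : ℝ} (ht0 : 0 ≤ t) (ht1 : t ≤ 1)
    {n : ℕ} (hsn : s ≤ n) (hn : Odd n) :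
    ∃ ℓ : ℕ, ℓ ≤ n ∧ (∃ y : ℤ, (2 * ℓ - n) * r - y * s = e) ∧
      |(2 * ℓ - n : ℝ) - t * n| ≤ s := by
  obtain ⟨a, c, hac⟩ := Nat.isCoprime_iff_coprime.2 hco
  have hs' : (0 : ℝ) < s := by exact_mod_cast hs
  have hsn' : (s : ℝ) ≤ n := by exact_mod_cast hsn
  have hse' : Even (s : ℤ) := by exact_mod_cast hse
  have hn' : Odd (n : ℤ) := by exact_mod_cast hn
  set w : ℤ := ⌊(t * n - (e * a : ℤ)) / (s : ℝ)⌋ with hw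
  have hw1 := Int.floor_le ((t * n - (e * a : ℤ)) / (s : ℝ))
  have hw2 := Int.lt_floor_add_one ((t * n - (e * a : ℤ)) / (s : ℝ))
  rw [← hw, le_div_iff₀ hs'] at hw1
  rw [← hw, div_lt_iff₀ hs'] at hw2
  set d : ℤ := e * a + s * w with hd
  have hd1 : (d : ℝ) ≤ t * n := by
    rw [hd]
    push_cast at hw1 ⊢
    linarith
  have hd2 : t * n - s ≤ (d : ℝ) := by
    rw [hd]
    push_cast at hw2 ⊢
    linarith
  have hdn : d ≤ n := by
    have : (d : ℝ) ≤ n := hd1.trans (mul_le_of_le_one_left (by positivity) ht1)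
    exact_mod_cast this
  have hdn' : -(n : ℤ) ≤ d := by
    have : -(n : ℝ) ≤ d := by
      have : 0 ≤ t * n := by positivity
      linarith
    exact_mod_cast this
  have ha : Odd a := by
    have h1 : Odd (a * r) := by
      rw [show a * (r : ℤ) = 1 - c * s by linarith]
      exact odd_one.sub_even (hse'.mul_left c)
    exact (Int.odd_mul.1 h1).1
  have hdo : Odd d := (he.mul ha).add_even (hse'.mul_right w)
  obtain ⟨q, hq⟩ := hn'.add_odd hdo
  lift q to ℕ using by omega
  have hq2 : 2 * (q : ℤ) - n = d := by omega
  have hq3 : (2 * q - n : ℝ) = d := by exact_mod_cast hq2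
  refine ⟨q, by omega, ⟨r * w - e * c, ?_⟩, ?_⟩
  · rw [hq2, hd]
    linear_combination e * hac
  · rw [hq3, abs_le]
    constructor <;> linarith

/-- The limiting quadratic loss has a unique minimiser over odd `k` and `A` of the sign of `e`. -/
lemma eq_of_quadratic_loss_le {e k : ℤ} (he : e = 1 ∨ e = -1) (hk : Odd k) {A : ℝ}
    (hA : 0 ≤ e * A) (h : (k : ℝ) ^ 2 - k * A + 5 / 12 * A ^ 2 ≤ 2 / 5) : e * A = 6 / 5 := by
  have h1 : (k : ℝ) ^ 2 ≤ 1 := by nlinarith [sq_nonneg (A - 6 * k / 5)]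
  have h2 : k ^ 2 ≤ 1 := by exact_mod_cast h1
  have h3 : k ≤ 1 := by nlinarith
  have h4 : -1 ≤ k := by nlinarith
  have h5 : k ≠ 0 := by
    rintro rfl
    simp at hk
  have h6 : k = 1 ∨ k = -1 := by omega
  have h7 : A = 6 * k / 5 := by
    have : (A - 6 * k / 5) ^ 2 ≤ 0 := by
      rcases h6 with rfl | rfl <;> push_cast at h ⊢ <;> nlinarith
    nlinarith [pow_eq_zero_iff (two_ne_zero) |>.1 (le_antisymm this (sq_nonneg _))]
  rcases he with rfl | rfl <;> rcases h6 with rfl | rfl <;> push_cast at * <;> linarith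

/-- for `p = r/s` with `s` even and `p ≠ 1/2`, for odd `n`, any optimal
number `ℓ` of `+1` coefficients (with `ℓ ≥ n/2`) satisfies
`ℓ = (1/2 + 3/(5|1-2p|s) + o(1)) n`.  The optimality hypothesis
`∀ ℓ' ≤ n, ∀ y', ∃ y, D ℓ' _ y' ≤ D ℓ _ y` encodes
`max_y D(ℓ, n-ℓ, p, y) ≥ max_y D(ℓ', n-ℓ', p, y)` (both maxima are attained since
`y ↦ D` has finite support). -/
theorem stmt_12 (r s : ℕ) (hr : 0 < r) (hs : 0 < s) (hco : Nat.Coprime r s)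
    (hse : Even s) (hrs : r < s) (hp : (r : ℝ) / (s : ℝ) ≠ 1 / 2) :
    ∀ ε : ℝ, 0 < ε → ∃ N : ℕ, ∀ n : ℕ, N ≤ n → Odd n →
      ∀ ℓ : ℕ, n ≤ 2 * ℓ → ℓ ≤ n →
        (∀ ℓ' : ℕ, ℓ' ≤ n → ∀ y' : ℤ, ∃ y : ℤ,
          D ℓ' (n - ℓ') ((r : ℝ) / (s : ℝ)) y' ≤ D ℓ (n - ℓ) ((r : ℝ) / (s : ℝ)) y) →
        |(ℓ : ℝ) - (1 / 2 + 3 / (5 * |1 - 2 * ((r : ℝ) / (s : ℝ))| * (s : ℝ))) * (n : ℝ)|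
          ≤ ε * (n : ℝ) := by
  set p : ℝ := (r : ℝ) / s with hpdef
  have hs' : (0 : ℝ) < s := by exact_mod_cast hs
  have hr' : (0 : ℝ) < r := by exact_mod_cast hr
  have hp0 : 0 < p := div_pos hr' hs'
  have hp1 : p < 1 := (div_lt_one hs').2 (by exact_mod_cast hrs)
  have hps : p * s = r := div_mul_cancel₀ _ hs'.ne'
  have hr_odd : Odd (r : ℤ) := by
    have h : Odd r := by
      by_contra h
      have h2 := Nat.dvd_gcd (Nat.not_odd_iff_even.1 h).two_dvd hse.two_dvd
      rw [hco.gcd_eq_one] at h2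
      omega
    exact_mod_cast h
  have hse' : Even (s : ℤ) := by exact_mod_cast hse
  have hne : 1 - 2 * p ≠ 0 := fun h => hp (by linarith)
  obtain ⟨e, he, hep⟩ : ∃ e : ℤ, (e = 1 ∨ e = -1) ∧ |1 - 2 * p| = e * (1 - 2 * p) := by
    rcases abs_choice (1 - 2 * p) with h | h
    · exact ⟨1, Or.inl rfl, by simp [h]⟩
    · exact ⟨-1, Or.inr rfl, by simp [h]⟩
  have he_odd : Odd e := by rcases he with rfl | rfl <;> decide
  have he2 : (e : ℝ) * e = 1 := by rcases he with rfl | rfl <;> norm_num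
  have habs : 0 < |1 - 2 * p| := abs_pos.2 hne
  have hs2 : 2 ≤ |1 - 2 * p| * s := by
    have h1 : |1 - 2 * p| * s = ((|(s : ℤ) - 2 * r| : ℤ) : ℝ) := by
      push_cast
      rw [← hps, ← abs_of_pos hs', ← abs_mul, abs_of_pos hs']
      congr 1
      ring
    have h2 : (s : ℤ) - 2 * r ≠ 0 := by
      intro h
      rw [h] at h1
      have : 0 < |1 - 2 * p| * s := by positivity
      simp [h1] at this
    have h3 : 2 ≤ |(s : ℤ) - 2 * r| := by
      obtain ⟨c, hc⟩ := hse'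
      rw [le_abs]
      omega
    rw [h1]
    exact_mod_cast h3
  set τ : ℝ := 6 / (5 * |1 - 2 * p| * s) with hτ
  have hτ0 : 0 ≤ τ := by positivity
  have hτ1 : τ ≤ 1 := by
    rw [hτ, div_le_one (by positivity)]
    linarith
  have hτe : τ * (1 - 2 * p) = 6 * e / (5 * s) := by
    have h0 : (e : ℝ) ≠ 0 := fun h => by simp [h] at he2
    rw [hτ, hep]
    field_simp
    linear_combination -he2
  by_contra hcon
  push Not at hcon
  obtain ⟨ε, hε, hcon⟩ := hcon
  have hseq : ∀ j : ℕ, ∃ n : ℕ, j + s ≤ n ∧ ∃ ℓ : ℕ, n ≤ 2 * ℓ ∧ ℓ ≤ n ∧ Odd n ∧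
      2 * ε < |(2 * ℓ - n : ℝ) / n - τ| ∧
      ∃ y : ℤ, ∃ d' : ℝ, |d'| ≤ n ∧ |d' - τ * n| ≤ s ∧
        deficit p n (2 * ℓ - n) ((2 * ℓ - n) * p - y) ≤ deficit p n d' (e / s) := by
    intro j
    obtain ⟨n, hn, hodd, ℓ, hℓ, hℓn, hopt, hfar⟩ := hcon (j + s)
    have hn0 : (0 : ℝ) < n := by exact_mod_cast (by omega : 0 < n)
    refine ⟨n, hn, ℓ, hℓ, hℓn, hodd, ?_, ?_⟩
    · have h1 : (ℓ : ℝ) - (1 / 2 + 3 / (5 * |1 - 2 * p| * s)) * n =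
          n / 2 * ((2 * ℓ - n : ℝ) / n - τ) := by
        rw [hτ]
        field_simp
        ring
      rw [h1, abs_mul, abs_of_pos (by positivity)] at hfar
      nlinarith
    · obtain ⟨ℓ', hℓ', ⟨y', hy'⟩, hd'⟩ :=
        exists_near_optimal_imbalance hs hco hse he_odd hτ0 hτ1 (by omega : s ≤ n) hodd
      obtain ⟨y, hy⟩ := hopt ℓ' hℓ' y'
      have hb' : (2 * ℓ' - n : ℝ) * p - y' = e / s := by
        rw [eq_div_iff hs'.ne', ← (by exact_mod_cast hy' :
          (2 * ℓ' - n : ℝ) * r - y' * s = e), ← hps]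
        ring
      refine ⟨y, 2 * ℓ' - n, ?_, hd', ?_⟩
      · have : (ℓ' : ℝ) ≤ n := by exact_mod_cast hℓ'
        rw [abs_le]
        constructor <;> linarith [(ℓ'.cast_nonneg : (0 : ℝ) ≤ ℓ')]
      · have h1 := two_pi_mul_D_eq_sub_deficit hp0.le hp1.le hp hℓn y
        have h2 := two_pi_mul_D_eq_sub_deficit hp0.le hp1.le hp hℓ' y'
        rw [hb'] at h2
        have h3 := mul_le_mul_of_nonneg_left hy (by positivity : 0 ≤ 2 * Real.pi)
        linarith
  choose n hn ℓ hℓ hℓn hodd hfar y d' hd'n hd'τ hle using hseq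
  have hn0 : ∀ j, 0 < n j := fun j => by have := hn j; omega
  have hn0' : ∀ j, (0 : ℝ) < n j := fun j => by exact_mod_cast hn0 j
  have hntop : Filter.Tendsto n Filter.atTop Filter.atTop :=
    Filter.tendsto_atTop_mono (fun j => (Nat.le_add_right j s).trans (hn j)) Filter.tendsto_id
  have hntop' : Filter.Tendsto (fun j => (n j : ℝ)) Filter.atTop Filter.atTop :=
    tendsto_natCast_atTop_atTop.comp hntop
  set d : ℕ → ℝ := fun j => 2 * ℓ j - n j with hd
  set b : ℕ → ℝ := fun j => d j * p - y j with hb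
  have hd0 : ∀ j, 0 ≤ d j := fun j => by
    have : (n j : ℝ) ≤ 2 * ℓ j := by exact_mod_cast hℓ j
    simp only [hd]
    linarith
  have hdn : ∀ j, |d j| ≤ n j := fun j => by
    have : (ℓ j : ℝ) ≤ n j := by exact_mod_cast hℓn j
    rw [abs_of_nonneg (hd0 j)]
    simp only [hd]
    linarith
  have hpq : 0 < p * (1 - p) := mul_pos hp0 (by linarith)
  set M : ℝ := ∫ x : ℝ, x ^ 2 * Real.exp (-(p * (1 - p) / 2) * x ^ 2) with hM
  have hM0 : 0 < M := integral_sq_mul_exp_neg_sq_pos hpq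
  have hlimit : ∀ t β : ℝ, (∫ x : ℝ, Real.exp (-(p * (1 - p) / 2) * x ^ 2) *
        ((β * x - t * (p * (1 - p) * (1 - 2 * p)) * (x ^ 3 * (1 / 6))) ^ 2 / 2)) =
      M / 2 * (β ^ 2 - β * (t * (1 - 2 * p)) + 5 / 12 * (t * (1 - 2 * p)) ^ 2) := by
    intro t β
    rw [hM, ← integral_gaussian_mul_cubic_sq hpq]
    congr 1
    ext x
    ring
  have hd'lim : Filter.Tendsto (fun j => d' j / n j) Filter.atTop (nhds τ) := by
    rw [tendsto_iff_norm_sub_tendsto_zero]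
    refine squeeze_zero (fun j => norm_nonneg _) (fun j => ?_)
      (Filter.Tendsto.const_div_atTop hntop' (s : ℝ))
    rw [Real.norm_eq_abs, show d' j / n j - τ = (d' j - τ * n j) / n j by
      have := (hn0' j).ne'
      field_simp, abs_div, abs_of_pos (hn0' j)]
    have := hn0' j
    gcongr
    exact hd'τ j
  have hcmp := tendsto_deficit hp0 hp1 hp hntop hn0 hd'n hd'lim
    (tendsto_const_nhds (x := (e : ℝ) / s))
  rw [hlimit, hτe] at hcmp
  obtain ⟨C, hC⟩ := exists_le_sqrt_pow_three_mul_deficit hp0.le hp1.le hp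
  obtain ⟨K, hK⟩ := hcmp.bddAbove_range
  have hscaled : ∀ j, √(n j : ℝ) ^ 3 * deficit p (n j) (d j) (b j) ≤
      √(n j : ℝ) ^ 3 * deficit p (n j) (d' j) (e / s) := fun j =>
    mul_le_mul_of_nonneg_left (hle j) (by positivity)
  have hbdd : ∀ᶠ j in Filter.atTop, (d j / n j, b j) ∈
      Set.Icc (0 : ℝ) 1 ×ˢ Metric.closedBall (0 : ℝ) (√(2 * Real.pi ^ 2 * (4 / 3 * K + C))) := by
    filter_upwards [hntop'.eventually_gt_atTop (2 * (4 / 3 * K + C))] with j hj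
    refine ⟨⟨div_nonneg (hd0 j) (hn0' j).le, ?_⟩, ?_⟩
    · rw [div_le_one (hn0' j)]
      exact (le_abs_self _).trans (hdn j)
    · rw [mem_closedBall_zero_iff, Real.norm_eq_abs]
      apply Real.abs_le_sqrt
      have h1 := (hC (n j) (hn0 j) (d j) (b j) (hdn j)).trans ((hscaled j).trans (hK ⟨j, rfl⟩))
      have h2 := min_le_mul_one_sub_sinc (hn0 j) (b j)
      rcases min_le_iff.1 h2 with h3 | h3
      · rw [div_le_iff₀ (by positivity)] at h3
        refine h3.trans ?_
        rw [mul_comm]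
        gcongr
        linarith
      · linarith
  obtain ⟨⟨t, β⟩, hmem, φ, hφ, hlim⟩ :=
    (isCompact_Icc.prod (isCompact_closedBall _ _)).tendsto_subseq' hbdd.frequently
  have ht0 : 0 ≤ t := hmem.1.1
  have htlim : Filter.Tendsto (fun j => d (φ j) / n (φ j)) Filter.atTop (nhds t) :=
    (continuous_fst.tendsto _).comp hlim
  have hblim : Filter.Tendsto (fun j => b (φ j)) Filter.atTop (nhds β) :=
    (continuous_snd.tendsto _).comp hlim
  have hopt := tendsto_deficit hp0 hp1 hp (hntop.comp hφ.tendsto_atTop) (fun j => hn0 (φ j))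
    (fun j => hdn (φ j)) htlim hblim
  rw [hlimit] at hopt
  have hineq := le_of_tendsto_of_tendsto' hopt (hcmp.comp hφ.tendsto_atTop)
    (fun j => hscaled (φ j))
  obtain ⟨k, hk, hkβ⟩ : ∃ k : ℤ, Odd k ∧ (k : ℝ) = s * β := by
    have hcl : IsClosed ((fun k : ℤ => (k : ℝ)) '' {k | Odd k}) :=
      Int.isClosedEmbedding_coe_real.isClosedMap _ (isClosed_discrete _)
    exact hcl.mem_of_tendsto (hblim.const_mul (s : ℝ)) (Filter.Eventually.of_forall fun j =>
      ⟨(2 * ℓ (φ j) - n (φ j)) * r - y (φ j) * s, by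
        have hno : Odd (n (φ j) : ℤ) := by exact_mod_cast hodd (φ j)
        exact (((even_two_mul _).sub_odd hno).mul hr_odd).sub_even (hse'.mul_left _), by
        simp only [hb, hd]
        push_cast
        rw [← hps]
        ring⟩)
  have hA := eq_of_quadratic_loss_le he hk (A := s * (t * (1 - 2 * p)))
    (by
      rw [show (e : ℝ) * (s * (t * (1 - 2 * p))) = s * (t * (e * (1 - 2 * p))) by ring, ← hep]
      positivity)
    (by
      have h1 := le_of_mul_le_mul_left hineq (by positivity : 0 < M / 2)
      have h2 := mul_le_mul_of_nonneg_left h1 (by positivity : 0 ≤ (s : ℝ) ^ 2)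
      rw [hkβ]
      calc _ = (s : ℝ) ^ 2 * (β ^ 2 - β * (t * (1 - 2 * p)) +
            5 / 12 * (t * (1 - 2 * p)) ^ 2) := by ring
        _ ≤ _ := h2
        _ = e * e * (2 / 5) := by
            field_simp
            ring
        _ = 2 / 5 := by rw [he2, one_mul])
  have htτ : t = τ := by
    rw [hτ, eq_div_iff (by positivity), hep]
    linear_combination 5 * hA
  have hfin := le_of_tendsto_of_tendsto' tendsto_const_nhds (htlim.sub_const τ).abs
    (fun j => (hfar (φ j)).le)
  rw [htτ, sub_self, abs_zero] at hfin
  linarith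
end

section
/- Let p be an irrational real with 0 < p < 1. Then for every ε > 0 there exists N such that for every odd integer n ≥ N the following holds: if ℓ is an integer with 0 ≤ ℓ ≤ n such that max_{y ∈ ℤ} D(ℓ, n−ℓ, p, y) ≥ max_{y ∈ ℤ} D(ℓ', n−ℓ', p, y) for every integer 0 ≤ ℓ' ≤ n, then |ℓ − n/2| ≤ ε·n. That is, for irrational p and odd n, the optimal number of +1 coefficients is (1/2 + o(1))·n. -/
open Finset

open MeasureTheory

/-- The characteristic function of a Bernoulli variable of parameter `p`. -/
noncomputable def bernoulliChar (p θ : ℝ) : ℂ :=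
  (p : ℂ) * Complex.exp (θ * Complex.I) + (1 - p : ℝ)

/-- The real part of the inversion integrand of `Bin(ℓ,p) - Bin(m,p)` at `y`. -/
noncomputable def inversionIntegrand (ℓ m : ℕ) (p : ℝ) (y : ℤ) (θ : ℝ) : ℝ :=
  ‖bernoulliChar p θ‖ ^ (ℓ + m) *
    Real.cos (((ℓ : ℝ) - m) * (bernoulliChar p θ).arg - y * θ)

lemma bernoulliChar_re (p θ : ℝ) : (bernoulliChar p θ).re = 1 - p + p * Real.cos θ := by
  simp [bernoulliChar, Complex.exp_ofReal_mul_I_re]; ring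

lemma bernoulliChar_im (p θ : ℝ) : (bernoulliChar p θ).im = p * Real.sin θ := by
  simp [bernoulliChar, Complex.exp_ofReal_mul_I_im]

lemma continuous_bernoulliChar (p : ℝ) : Continuous (bernoulliChar p) := by
  unfold bernoulliChar; fun_prop

lemma norm_bernoulliChar_sq (p θ : ℝ) :
    ‖bernoulliChar p θ‖ ^ 2 = 1 - 2 * p * (1 - p) * (1 - Real.cos θ) := by
  rw [Complex.sq_norm, Complex.normSq_apply, bernoulliChar_re, bernoulliChar_im]
  linear_combination p ^ 2 * Real.sin_sq_add_cos_sq θ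

lemma inversionIntegrand_eq_re (ℓ m : ℕ) (p : ℝ) (y : ℤ) (θ : ℝ) :
    inversionIntegrand ℓ m p y θ =
      (bernoulliChar p θ ^ ℓ * (starRingEnd ℂ) (bernoulliChar p θ) ^ m *
        Complex.exp (-(y * θ : ℝ) * Complex.I)).re := by
  have hz := Complex.norm_mul_exp_arg_mul_I (bernoulliChar p θ)
  set r := ‖bernoulliChar p θ‖ with hr
  set w := (bernoulliChar p θ).arg with hw
  have hc : (starRingEnd ℂ) (bernoulliChar p θ) = r * Complex.exp (-w * Complex.I) := by
    rw [← hz, map_mul, Complex.conj_ofReal, ← Complex.exp_conj]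
    simp
  have key : bernoulliChar p θ ^ ℓ * (starRingEnd ℂ) (bernoulliChar p θ) ^ m *
        Complex.exp (-(y * θ : ℝ) * Complex.I) =
      (r ^ (ℓ + m) : ℝ) * Complex.exp ((((ℓ : ℝ) - m) * w - y * θ : ℝ) * Complex.I) := by
    rw [hc, ← hz, mul_pow, mul_pow, ← Complex.exp_nat_mul, ← Complex.exp_nat_mul]
    rw [show ((((ℓ : ℝ) - m) * w - y * θ : ℝ) * Complex.I) = ℓ * (w * Complex.I) +
      m * (-w * Complex.I) + (-(y * θ : ℝ) * Complex.I) by push_cast; ring, Complex.exp_add,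
      Complex.exp_add]
    push_cast
    ring
  rw [key, Complex.re_ofReal_mul, Complex.exp_ofReal_mul_I_re, inversionIntegrand]

lemma continuous_inversionIntegrand (ℓ m : ℕ) (p : ℝ) (y : ℤ) :
    Continuous (inversionIntegrand ℓ m p y) := by
  have h : inversionIntegrand ℓ m p y = fun θ =>
      (bernoulliChar p θ ^ ℓ * (starRingEnd ℂ) (bernoulliChar p θ) ^ m *
        Complex.exp (-(y * θ : ℝ) * Complex.I)).re :=
    funext (inversionIntegrand_eq_re ℓ m p y)
  rw [h]
  have := continuous_bernoulliChar p
  have h2 : Continuous fun θ => (starRingEnd ℂ) (bernoulliChar p θ) :=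
    Complex.continuous_conj.comp this
  fun_prop

lemma inversionIntegrand_eq_sum (ℓ m : ℕ) (p : ℝ) (y : ℤ) (θ : ℝ) :
    inversionIntegrand ℓ m p y θ =
      ∑ k ∈ Finset.range (ℓ + 1), ∑ j ∈ Finset.range (m + 1),
        (ℓ.choose k : ℝ) * (m.choose j : ℝ) * p ^ (k + j) * (1 - p) ^ ((ℓ - k) + (m - j)) *
          Real.cos (((k : ℤ) - (j : ℤ) - y : ℤ) * θ) := by
  have hc : (starRingEnd ℂ) (bernoulliChar p θ) =
      (p : ℂ) * Complex.exp (-θ * Complex.I) + (1 - p : ℝ) := by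
    rw [bernoulliChar, map_add, map_mul, Complex.conj_ofReal, Complex.conj_ofReal,
      ← Complex.exp_conj]
    simp
  rw [inversionIntegrand_eq_re, hc, bernoulliChar, add_pow, add_pow, Finset.sum_mul_sum,
    Finset.sum_mul, Complex.re_sum]
  refine Finset.sum_congr rfl fun k _ => ?_
  rw [Finset.sum_mul, Complex.re_sum]
  refine Finset.sum_congr rfl fun j _ => ?_
  rw [← Complex.exp_ofReal_mul_I_re, ← Complex.re_ofReal_mul]
  congr 1
  rw [show ((((k : ℤ) - (j : ℤ) - y : ℤ) * θ : ℝ) * Complex.I) = k * (θ * Complex.I) +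
      j * (-θ * Complex.I) + (-(y * θ : ℝ) * Complex.I) by push_cast; ring, Complex.exp_add,
      Complex.exp_add, Complex.exp_nat_mul, Complex.exp_nat_mul]
  push_cast
  ring

lemma integral_cos_int_mul (N : ℤ) :
    ∫ θ in (-Real.pi)..Real.pi, Real.cos (N * θ) = if N = 0 then 2 * Real.pi else 0 := by
  split_ifs with h
  · simp [h]; ring
  · have hN : (N : ℝ) ≠ 0 := by exact_mod_cast h
    rw [intervalIntegral.integral_comp_mul_left (fun x => Real.cos x) hN, integral_cos]
    simp [Real.sin_int_mul_pi]

lemma integral_inversionIntegrand (ℓ m : ℕ) (p : ℝ) (y : ℤ) :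
    ∫ θ in (-Real.pi)..Real.pi, inversionIntegrand ℓ m p y θ = 2 * Real.pi * D ℓ m p y := by
  simp only [inversionIntegrand_eq_sum]
  rw [intervalIntegral.integral_finsetSum]
  swap
  · intro k _
    exact Continuous.intervalIntegrable (by fun_prop) _ _
  rw [D, Finset.mul_sum]
  refine Finset.sum_congr rfl fun k _ => ?_
  rw [intervalIntegral.integral_finsetSum]
  swap
  · intro j _
    exact Continuous.intervalIntegrable (by fun_prop) _ _
  rw [Finset.mul_sum]
  refine Finset.sum_congr rfl fun j _ => ?_
  rw [intervalIntegral.integral_const_mul, integral_cos_int_mul]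
  by_cases h : (k : ℤ) - (j : ℤ) = y
  · rw [if_pos h, if_pos (by omega)]; ring
  · rw [if_neg h, if_neg (by omega)]; ring

lemma one_sub_cos_eq (x : ℝ) : 1 - Real.cos x = 2 * Real.sin (x / 2) ^ 2 := by
  have h := Real.cos_two_mul (x / 2)
  rw [mul_div_cancel₀ x two_ne_zero] at h
  linear_combination -h - 2 * Real.sin_sq_add_cos_sq (x / 2)

lemma two_div_pi_sq_mul_sq_le_one_sub_cos {x : ℝ} (hx : |x| ≤ Real.pi) :
    2 / Real.pi ^ 2 * x ^ 2 ≤ 1 - Real.cos x := by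
  have h : |x / 2| ≤ Real.pi / 2 := by
    rw [abs_div, abs_two]; linarith
  have h1 := Real.mul_abs_le_abs_sin h
  have h2 := mul_self_le_mul_self (by positivity) h1
  rw [one_sub_cos_eq]
  have h3 : |Real.sin (x / 2)| * |Real.sin (x / 2)| = Real.sin (x / 2) ^ 2 := by
    rw [← sq, sq_abs]
  have h4 : 2 / Real.pi * |x / 2| * (2 / Real.pi * |x / 2|) = x ^ 2 / Real.pi ^ 2 := by
    have : |x / 2| * |x / 2| = (x / 2) ^ 2 := by rw [← sq, sq_abs]
    calc _ = 4 / Real.pi ^ 2 * (|x / 2| * |x / 2|) := by ring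
      _ = _ := by rw [this]; ring
  rw [h3, h4] at h2
  calc _ = 2 * (x ^ 2 / Real.pi ^ 2) := by ring
    _ ≤ _ := by linarith

lemma sin_half_sub_two_mul_sq_le (a b : ℝ) :
    Real.sin ((a - 2 * b) / 2) ^ 2 ≤ (1 - Real.cos a) + 4 * (1 - Real.cos b) := by
  rw [one_sub_cos_eq a, one_sub_cos_eq b,
    show (a - 2 * b) / 2 = a / 2 - 2 * (b / 2) by ring, Real.sin_sub, Real.sin_two_mul]
  set s := Real.sin (a / 2) * Real.cos (2 * (b / 2))
  set t := 2 * Real.sin (b / 2) * Real.cos (b / 2)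
  set u := Real.cos (a / 2)
  have h1 : s ^ 2 ≤ Real.sin (a / 2) ^ 2 := by
    rw [mul_pow]
    exact mul_le_of_le_one_right (sq_nonneg _) (Real.cos_sq_le_one _)
  have h2 : (u * t) ^ 2 ≤ 4 * Real.sin (b / 2) ^ 2 := by
    have h3 : t ^ 2 ≤ 4 * Real.sin (b / 2) ^ 2 := by
      have : t ^ 2 = 4 * Real.sin (b / 2) ^ 2 * Real.cos (b / 2) ^ 2 := by ring
      rw [this]
      exact mul_le_of_le_one_right (by positivity) (Real.cos_sq_le_one _)
    rw [mul_pow]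
    exact (mul_le_of_le_one_left (sq_nonneg _) (Real.cos_sq_le_one _)).trans h3
  nlinarith [sq_nonneg (s + u * t)]

lemma norm_bernoulliChar_le_one {p : ℝ} (hp0 : 0 < p) (hp1 : p < 1) (θ : ℝ) :
    ‖bernoulliChar p θ‖ ≤ 1 := by
  have h := norm_bernoulliChar_sq p θ
  have h1 : 0 ≤ 2 * p * (1 - p) * (1 - Real.cos θ) :=
    mul_nonneg (mul_nonneg (by linarith) (by linarith)) (by linarith [Real.cos_le_one θ])
  nlinarith [norm_nonneg (bernoulliChar p θ)]

lemma one_sub_sq_le_norm_bernoulliChar {p : ℝ} (hp0 : 0 < p) (hp1 : p < 1) (θ : ℝ) :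
    1 - θ ^ 2 / 4 ≤ ‖bernoulliChar p θ‖ := by
  have h := norm_bernoulliChar_sq p θ
  have h1 := norm_bernoulliChar_le_one hp0 hp1 θ
  have h2 : p * (1 - p) ≤ 1 / 4 := by nlinarith [sq_nonneg (p - 1 / 2)]
  have h3 : 1 - Real.cos θ ≤ θ ^ 2 / 2 := by linarith [Real.one_sub_sq_div_two_le_cos (x := θ)]
  have h4 : p * (1 - p) * (1 - Real.cos θ) ≤ 1 / 4 * (θ ^ 2 / 2) :=
    mul_le_mul h2 h3 (by linarith [Real.cos_le_one θ]) (by norm_num)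
  nlinarith [norm_nonneg (bernoulliChar p θ)]

lemma abs_arg_bernoulliChar_le {p : ℝ} (hp0 : 0 < p) (hp1 : p < 1) {θ : ℝ} (hθ : |θ| ≤ 1 / 8) :
    |(bernoulliChar p θ).arg| ≤ Real.pi / 2 * (4 / 3 * |θ|) := by
  have hθ2 : θ ^ 2 ≤ 1 / 64 := by
    rw [← sq_abs]; nlinarith [abs_nonneg θ]
  have hre : 0 ≤ (bernoulliChar p θ).re := by
    rw [bernoulliChar_re]
    nlinarith [Real.one_sub_sq_div_two_le_cos (x := θ)]
  have h1 := Real.mul_abs_le_abs_sin (Complex.abs_arg_le_pi_div_two_iff.2 hre)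
  have hr := one_sub_sq_le_norm_bernoulliChar hp0 hp1 θ
  have hr' : 3 / 4 ≤ ‖bernoulliChar p θ‖ := by linarith
  have h2 : |Real.sin (bernoulliChar p θ).arg| ≤ 4 / 3 * |θ| := by
    rw [Complex.sin_arg, abs_div, abs_norm, bernoulliChar_im, abs_mul, abs_of_pos hp0,
      div_le_iff₀ (by linarith)]
    have h3 := Real.abs_sin_le_abs (x := θ)
    nlinarith [abs_nonneg θ, abs_nonneg (Real.sin θ)]
  have hpi := Real.pi_pos
  calc |(bernoulliChar p θ).arg| = Real.pi / 2 * (2 / Real.pi * |(bernoulliChar p θ).arg|) := by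
        field_simp
    _ ≤ _ := mul_le_mul_of_nonneg_left (h1.trans h2) (by positivity)

/-- The second difference at `0` of the argument of the characteristic function. -/
noncomputable def argDefect (p θ : ℝ) : ℝ :=
  (bernoulliChar p (2 * θ)).arg - 2 * (bernoulliChar p θ).arg

lemma norm_mul_sin_argDefect (p θ : ℝ) :
    ‖bernoulliChar p (2 * θ)‖ * ‖bernoulliChar p θ‖ ^ 2 * Real.sin (argDefect p θ) =
      -(2 * p * (1 - p) * (1 - 2 * p) * (Real.sin θ * (1 - Real.cos θ))) := by
  have a1 := Complex.norm_mul_cos_arg (bernoulliChar p θ)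
  have a2 := Complex.norm_mul_sin_arg (bernoulliChar p θ)
  have b1 := Complex.norm_mul_cos_arg (bernoulliChar p (2 * θ))
  have b2 := Complex.norm_mul_sin_arg (bernoulliChar p (2 * θ))
  rw [bernoulliChar_re] at a1 b1
  rw [bernoulliChar_im] at a2 b2
  rw [Real.cos_two_mul] at b1
  rw [Real.sin_two_mul] at b2
  rw [argDefect, Real.sin_sub, Real.sin_two_mul, Real.cos_two_mul']
  set r := ‖bernoulliChar p θ‖
  set R := ‖bernoulliChar p (2 * θ)‖
  set w := (bernoulliChar p θ).arg
  set W := (bernoulliChar p (2 * θ)).arg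
  have hs : Real.sin θ ^ 2 = 1 - Real.cos θ ^ 2 := Real.sin_sq θ
  calc _ = (R * Real.sin W) * ((r * Real.cos w) ^ 2 - (r * Real.sin w) ^ 2) -
        (R * Real.cos W) * (2 * (r * Real.sin w) * (r * Real.cos w)) := by ring
    _ = _ := by
      rw [a1, a2, b1, b2]
      linear_combination (-2 * p ^ 3 * Real.sin θ * Real.cos θ) * hs

lemma argDefect_bounds {p : ℝ} (hp0 : 0 < p) (hp1 : p < 1) {θ : ℝ} (h0 : 0 < θ)
    (hθ : θ ≤ 1 / 16) :
    8 / Real.pi ^ 3 * (p * (1 - p) * |1 - 2 * p|) * θ ^ 3 ≤ |argDefect p θ| ∧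
      |argDefect p θ| ≤ θ ^ 3 := by
  have hpi := Real.pi_pos
  have hpi3 := Real.pi_gt_three
  have hpi4 := Real.pi_lt_d2
  set s := Real.sin θ * (1 - Real.cos θ) with hs
  set c := p * (1 - p) * |1 - 2 * p| with hc
  have hq : 0 < p * (1 - p) := mul_pos hp0 (by linarith)
  have hc0 : 0 ≤ c := by positivity
  have hc1 : c ≤ 1 / 4 := by
    have h1 : p * (1 - p) ≤ 1 / 4 := by nlinarith [sq_nonneg (p - 1 / 2)]
    have h2 : |1 - 2 * p| ≤ 1 := abs_le.2 ⟨by linarith, by linarith⟩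
    nlinarith [abs_nonneg (1 - 2 * p)]
  have hsin1 : 2 / Real.pi * θ ≤ Real.sin θ := Real.mul_le_sin h0.le (by linarith)
  have hsin2 : Real.sin θ ≤ θ := Real.sin_le h0.le
  have hcos1 : 2 / Real.pi ^ 2 * θ ^ 2 ≤ 1 - Real.cos θ :=
    two_div_pi_sq_mul_sq_le_one_sub_cos (by rw [abs_of_pos h0]; linarith)
  have hcos2 : 1 - Real.cos θ ≤ θ ^ 2 / 2 := by
    linarith [Real.one_sub_sq_div_two_le_cos (x := θ)]
  have hsin0 : 0 ≤ Real.sin θ := le_trans (by positivity) hsin1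
  have hcos0 : 0 ≤ 1 - Real.cos θ := le_trans (by positivity) hcos1
  have hs0 : 0 ≤ s := mul_nonneg hsin0 hcos0
  have hs1 : 4 / Real.pi ^ 3 * θ ^ 3 ≤ s := by
    calc _ = (2 / Real.pi * θ) * (2 / Real.pi ^ 2 * θ ^ 2) := by ring
      _ ≤ _ := mul_le_mul hsin1 hcos1 (by positivity) hsin0
  have hs2 : s ≤ θ ^ 3 / 2 := by
    calc s ≤ θ * (θ ^ 2 / 2) := mul_le_mul hsin2 hcos2 hcos0 h0.le
      _ = _ := by ring
  have hid := congrArg abs (norm_mul_sin_argDefect p θ)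
  rw [abs_mul, abs_mul, abs_norm, abs_of_nonneg (sq_nonneg ‖bernoulliChar p θ‖), abs_neg, ← hs,
    abs_mul, abs_mul, abs_of_nonneg hs0, mul_assoc 2 p, abs_of_nonneg (by positivity :
    0 ≤ 2 * (p * (1 - p)))] at hid
  have hid' : ‖bernoulliChar p (2 * θ)‖ * ‖bernoulliChar p θ‖ ^ 2 * |Real.sin (argDefect p θ)| =
      2 * c * s := by rw [hid, hc]; ring
  have hr1 := norm_bernoulliChar_le_one hp0 hp1 θ
  have hR1 := norm_bernoulliChar_le_one hp0 hp1 (2 * θ)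
  have hr2 : 3 / 4 ≤ ‖bernoulliChar p θ‖ := by
    nlinarith [one_sub_sq_le_norm_bernoulliChar hp0 hp1 θ]
  have hR2 : 3 / 4 ≤ ‖bernoulliChar p (2 * θ)‖ := by
    nlinarith [one_sub_sq_le_norm_bernoulliChar hp0 hp1 (2 * θ)]
  set r := ‖bernoulliChar p θ‖
  set R := ‖bernoulliChar p (2 * θ)‖
  have hRr1 : R * r ^ 2 ≤ 1 :=
    mul_le_one₀ hR1 (by positivity) (pow_le_one₀ (by linarith) hr1)
  have hRr2 : 3 / 4 * (3 / 4) ^ 2 ≤ R * r ^ 2 := by gcongr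
  have habs : |argDefect p θ| ≤ Real.pi / 2 := by
    have h1 := abs_arg_bernoulliChar_le hp0 hp1 (θ := θ) (by rw [abs_of_pos h0]; linarith)
    have h2 := abs_arg_bernoulliChar_le hp0 hp1 (θ := 2 * θ)
      (by rw [abs_of_pos (by linarith)]; linarith)
    rw [abs_of_pos h0] at h1
    rw [abs_of_pos (by linarith : 0 < 2 * θ)] at h2
    have h3 : |argDefect p θ| ≤
        |(bernoulliChar p (2 * θ)).arg| + 2 * |(bernoulliChar p θ).arg| := by
      refine (abs_sub _ _).trans ?_
      rw [abs_mul, abs_two]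
    nlinarith
  have hsin := Real.mul_abs_le_abs_sin habs
  have hle := Real.abs_sin_le_abs (x := argDefect p θ)
  have hnn := abs_nonneg (Real.sin (argDefect p θ))
  constructor
  · calc _ = 2 * c * (4 / Real.pi ^ 3 * θ ^ 3) := by ring
      _ ≤ 2 * c * s := by gcongr
      _ ≤ |Real.sin (argDefect p θ)| := by
        rw [← hid']; exact mul_le_of_le_one_left hnn hRr1
      _ ≤ _ := hle
  · have h1 : 27 / 64 * |Real.sin (argDefect p θ)| ≤ 1 / 4 * θ ^ 3 := by
      calc _ ≤ R * r ^ 2 * |Real.sin (argDefect p θ)| := by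
            apply mul_le_mul_of_nonneg_right _ hnn; linarith
        _ = 2 * c * s := hid'
        _ ≤ 2 * (1 / 4) * (θ ^ 3 / 2) := by gcongr
        _ = _ := by ring
    have h2 : |argDefect p θ| = Real.pi / 2 * (2 / Real.pi * |argDefect p θ|) := by
      field_simp
    rw [h2]
    have h3 : 0 < θ ^ 3 := by positivity
    calc _ ≤ Real.pi / 2 * |Real.sin (argDefect p θ)| := by gcongr
      _ ≤ Real.pi / 2 * (16 / 27 * θ ^ 3) := by gcongr; linarith
      _ ≤ _ := by nlinarith

/-- The nonnegative gap between the norm and the real part of the inversion integrand. -/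
noncomputable def inversionDeficit (ℓ m : ℕ) (p : ℝ) (y : ℤ) (θ : ℝ) : ℝ :=
  ‖bernoulliChar p θ‖ ^ (ℓ + m) - inversionIntegrand ℓ m p y θ

lemma inversionDeficit_eq (ℓ m : ℕ) (p : ℝ) (y : ℤ) (θ : ℝ) :
    inversionDeficit ℓ m p y θ = ‖bernoulliChar p θ‖ ^ (ℓ + m) *
      (1 - Real.cos (((ℓ : ℝ) - m) * (bernoulliChar p θ).arg - y * θ)) := by
  rw [inversionDeficit, inversionIntegrand]; ring

lemma inversionDeficit_nonneg (ℓ m : ℕ) (p : ℝ) (y : ℤ) (θ : ℝ) :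
    0 ≤ inversionDeficit ℓ m p y θ := by
  rw [inversionDeficit_eq]
  exact mul_nonneg (by positivity) (sub_nonneg.2 (Real.cos_le_one _))

lemma continuous_norm_bernoulliChar_pow (p : ℝ) (n : ℕ) :
    Continuous fun θ => ‖bernoulliChar p θ‖ ^ n :=
  (continuous_bernoulliChar p).norm.pow n

lemma continuous_inversionDeficit (ℓ m : ℕ) (p : ℝ) (y : ℤ) :
    Continuous (inversionDeficit ℓ m p y) :=
  (continuous_norm_bernoulliChar_pow p _).sub (continuous_inversionIntegrand ℓ m p y)

lemma integral_inversionDeficit (ℓ m : ℕ) (p : ℝ) (y : ℤ) :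
    ∫ θ in (-Real.pi)..Real.pi, inversionDeficit ℓ m p y θ =
      (∫ θ in (-Real.pi)..Real.pi, ‖bernoulliChar p θ‖ ^ (ℓ + m)) -
        2 * Real.pi * D ℓ m p y := by
  rw [← integral_inversionIntegrand]
  exact intervalIntegral.integral_sub
    ((continuous_norm_bernoulliChar_pow p _).intervalIntegrable _ _)
    ((continuous_inversionIntegrand ℓ m p y).intervalIntegrable _ _)

lemma three_quarters_le_norm_pow {p : ℝ} (hp0 : 0 < p) (hp1 : p < 1) {n : ℕ} {θ : ℝ}
    (hθ : n * θ ^ 2 ≤ 1) (hθ1 : θ ^ 2 ≤ 1) : 3 / 4 ≤ ‖bernoulliChar p θ‖ ^ n := by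
  have h1 := one_add_mul_le_pow (a := -(θ ^ 2 / 4)) (by linarith) n
  have h2 := pow_le_pow_left₀ (by linarith : 0 ≤ 1 - θ ^ 2 / 4)
    (one_sub_sq_le_norm_bernoulliChar hp0 hp1 θ) n
  rw [← sub_eq_add_neg] at h1
  linarith

lemma le_inversionDeficit_add {p : ℝ} (hp0 : 0 < p) (hp1 : p < 1) (ℓ m : ℕ) (y : ℤ) {h θ : ℝ}
    (h0 : 0 < h) (h1 : h ≤ 1 / 32) (hn : 16 * ((ℓ : ℝ) + m) * h ^ 2 = 1)
    (hθ : θ ∈ Set.Icc h (2 * h)) :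
    3 / 4 * (((ℓ : ℝ) - m) * (8 / Real.pi ^ 3 * (p * (1 - p) * |1 - 2 * p|) * h ^ 3) /
      Real.pi) ^ 2 ≤ inversionDeficit ℓ m p y (2 * θ) + 4 * inversionDeficit ℓ m p y θ := by
  obtain ⟨hθ1, hθ2⟩ := hθ
  have hpi := Real.pi_pos
  have hpi3 := Real.pi_gt_three
  have hθ0 : 0 < θ := by linarith
  set k : ℝ := (ℓ : ℝ) - m with hk
  set c := 8 / Real.pi ^ 3 * (p * (1 - p) * |1 - 2 * p|) with hc
  have hc0 : 0 ≤ c := by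
    have : 0 < p * (1 - p) := mul_pos hp0 (by linarith)
    positivity
  obtain ⟨hb1, hb2⟩ := argDefect_bounds hp0 hp1 hθ0 (by linarith)
  set β := argDefect p θ with hβ
  have hsq1 : θ ^ 2 ≤ 4 * h ^ 2 := by nlinarith
  have hnn : (0 : ℝ) ≤ (ℓ : ℝ) + m := by positivity
  have hr1 : 3 / 4 ≤ ‖bernoulliChar p θ‖ ^ (ℓ + m) := by
    apply three_quarters_le_norm_pow hp0 hp1
    · push_cast; nlinarith
    · nlinarith
  have hr2 : 3 / 4 ≤ ‖bernoulliChar p (2 * θ)‖ ^ (ℓ + m) := by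
    apply three_quarters_le_norm_pow hp0 hp1
    · push_cast; nlinarith
    · nlinarith
  have hkn : |k| ≤ (ℓ : ℝ) + m := by
    rw [abs_le]
    have h1 : (0 : ℝ) ≤ ℓ := by positivity
    have h2 : (0 : ℝ) ≤ m := by positivity
    constructor <;> linarith
  have hkβ : |k * β / 2| ≤ Real.pi / 2 := by
    rw [abs_div, abs_mul, abs_two]
    have h3 : θ ^ 3 ≤ (2 * h) ^ 3 := by gcongr
    have h4 : |k| * |β| ≤ ((ℓ : ℝ) + m) * (2 * h) ^ 3 := by
      gcongr
      exact hb2.trans h3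
    have h5 : ((ℓ : ℝ) + m) * (2 * h) ^ 3 = h / 2 := by
      linear_combination (h / 2) * hn
    linarith
  have hsin := Real.mul_abs_le_abs_sin hkβ
  have hlow : |k * (c * h ^ 3) / Real.pi| ≤ |Real.sin (k * β / 2)| := by
    refine le_trans ?_ hsin
    rw [abs_div, abs_div, abs_mul k, abs_mul k, abs_two, abs_of_pos hpi,
      abs_of_nonneg (by positivity : 0 ≤ c * h ^ 3)]
    have h3 : c * h ^ 3 ≤ |β| := by
      refine le_trans ?_ hb1
      gcongr
    calc _ ≤ |k| * |β| / Real.pi := by gcongr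
      _ = _ := by ring
  have htrig := sin_half_sub_two_mul_sq_le
    (k * (bernoulliChar p (2 * θ)).arg - y * (2 * θ)) (k * (bernoulliChar p θ).arg - y * θ)
  have harg : (k * (bernoulliChar p (2 * θ)).arg - y * (2 * θ) -
      2 * (k * (bernoulliChar p θ).arg - y * θ)) / 2 = k * β / 2 := by
    rw [hβ, argDefect]; ring
  rw [harg] at htrig
  rw [inversionDeficit_eq, inversionDeficit_eq, ← hk]
  have hsq := sq_le_sq.2 hlow
  set A := 1 - Real.cos (k * (bernoulliChar p (2 * θ)).arg - y * (2 * θ)) with hA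
  set B := 1 - Real.cos (k * (bernoulliChar p θ).arg - y * θ) with hB
  have hA0 : 0 ≤ A := sub_nonneg.2 (Real.cos_le_one _)
  have hB0 : 0 ≤ B := sub_nonneg.2 (Real.cos_le_one _)
  have e1 := mul_le_mul_of_nonneg_right hr1 hB0
  have e2 := mul_le_mul_of_nonneg_right hr2 hA0
  linarith

lemma le_integral_inversionDeficit {p : ℝ} (hp0 : 0 < p) (hp1 : p < 1) (ℓ m : ℕ) (y : ℤ) {h : ℝ}
    (h0 : 0 < h) (h1 : h ≤ 1 / 32) (hn : 16 * ((ℓ : ℝ) + m) * h ^ 2 = 1) :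
    h * (3 / 4 * (((ℓ : ℝ) - m) * (8 / Real.pi ^ 3 * (p * (1 - p) * |1 - 2 * p|) * h ^ 3) /
      Real.pi) ^ 2) ≤ 9 / 2 * ∫ θ in (-Real.pi)..Real.pi, inversionDeficit ℓ m p y θ := by
  have hpi3 := Real.pi_gt_three
  have hcont := continuous_inversionDeficit ℓ m p y
  have hcont2 : Continuous fun θ => inversionDeficit ℓ m p y (2 * θ) := by fun_prop
  have hle := intervalIntegral.integral_mono_on (μ := volume) (by linarith : h ≤ 2 * h)
    (continuous_const.intervalIntegrable _ _)
    ((hcont2.add (hcont.const_mul 4)).intervalIntegrable h (2 * h))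
    (fun θ hθ => le_inversionDeficit_add hp0 hp1 ℓ m y h0 h1 hn hθ)
  rw [intervalIntegral.integral_const, smul_eq_mul, show 2 * h - h = h by ring] at hle
  refine hle.trans ?_
  have hadd : ∫ θ in h..(2 * h), (inversionDeficit ℓ m p y (2 * θ) +
      4 * inversionDeficit ℓ m p y θ) = (∫ θ in h..(2 * h), inversionDeficit ℓ m p y (2 * θ)) +
      ∫ θ in h..(2 * h), 4 * inversionDeficit ℓ m p y θ :=
    intervalIntegral.integral_add (hcont2.intervalIntegrable _ _)
      ((hcont.const_mul 4).intervalIntegrable _ _)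
  have hsub : ∀ a b : ℝ, 0 ≤ a → a ≤ b → b ≤ 1 → ∫ θ in a..b, inversionDeficit ℓ m p y θ ≤
      ∫ θ in (-Real.pi)..Real.pi, inversionDeficit ℓ m p y θ := fun a b ha hab hb =>
    intervalIntegral.integral_mono_interval (by linarith) hab (by linarith)
      (Filter.Eventually.of_forall fun θ => inversionDeficit_nonneg ℓ m p y θ)
      (hcont.intervalIntegrable _ _)
  have e1 := hsub h (2 * h) h0.le (by linarith) (by linarith)
  have e2 := hsub (2 * h) (2 * (2 * h)) (by linarith) (by linarith) (by linarith)
  have e3 := intervalIntegral.integral_comp_mul_left (a := h) (b := 2 * h)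
    (inversionDeficit ℓ m p y) (two_ne_zero : (2 : ℝ) ≠ 0)
  rw [smul_eq_mul] at e3
  refine le_of_eq_of_le hadd ?_
  rw [e3, intervalIntegral.integral_const_mul]
  linarith

lemma abs_sin_nat_mul_le (k : ℕ) (x : ℝ) : |Real.sin (k * x)| ≤ k * |Real.sin x| := by
  induction k with
  | zero => simp
  | succ k ih =>
    rw [Nat.cast_succ, add_mul, one_mul, Real.sin_add]
    have h1 : |Real.sin (k * x) * Real.cos x| ≤ |Real.sin (k * x)| := by
      rw [abs_mul]
      exact mul_le_of_le_one_right (abs_nonneg _) (Real.abs_cos_le_one _)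
    have h2 : |Real.cos (k * x) * Real.sin x| ≤ |Real.sin x| := by
      rw [abs_mul]
      exact mul_le_of_le_one_left (abs_nonneg _) (Real.abs_cos_le_one _)
    linarith [abs_add_le (Real.sin (k * x) * Real.cos x) (Real.cos (k * x) * Real.sin x)]

lemma norm_exp_sub_one_sub_le (x : ℝ) :
    ‖Complex.exp (x * Complex.I) - 1 - x * Complex.I‖ ≤ 2 * x ^ 2 := by
  have hn : ‖(x : ℂ) * Complex.I‖ = |x| := by simp
  rcases le_or_gt |x| 1 with h | h
  · have := Complex.norm_exp_sub_one_sub_id_le (x := x * Complex.I) (by rw [hn]; exact h)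
    rw [hn, sq_abs] at this
    nlinarith [sq_nonneg x]
  · have h1 : ‖Complex.exp (x * Complex.I) - 1‖ ≤ |x| := by
      have := Real.norm_exp_I_mul_ofReal_sub_one_le (x := x)
      rwa [mul_comm, Real.norm_eq_abs] at this
    have h2 := norm_sub_le (Complex.exp (x * Complex.I) - 1) (x * Complex.I)
    rw [hn] at h2
    have h3 : x ^ 2 = |x| ^ 2 := (sq_abs x).symm
    nlinarith

lemma abs_sin_arg_sub_le {p : ℝ} (hp0 : 0 < p) (hp1 : p < 1) (θ : ℝ) :
    |Real.sin (((bernoulliChar p θ).arg - p * θ) / 2)| ≤ 4 * θ ^ 2 := by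
  set w := (bernoulliChar p θ).arg with hw
  have hz := Complex.norm_mul_exp_arg_mul_I (bernoulliChar p θ)
  have h1 : ‖bernoulliChar p θ - Complex.exp ((p * θ : ℝ) * Complex.I)‖ ≤ 4 * θ ^ 2 := by
    have e : bernoulliChar p θ - Complex.exp ((p * θ : ℝ) * Complex.I) =
        p * (Complex.exp (θ * Complex.I) - 1 - θ * Complex.I) -
        (Complex.exp ((p * θ : ℝ) * Complex.I) - 1 - (p * θ : ℝ) * Complex.I) := by
      rw [bernoulliChar]; push_cast; ring
    rw [e]
    refine (norm_sub_le _ _).trans ?_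
    rw [norm_mul, Complex.norm_real, Real.norm_of_nonneg hp0.le]
    have e1 := norm_exp_sub_one_sub_le θ
    have e2 := norm_exp_sub_one_sub_le (p * θ)
    have e3 : (p * θ) ^ 2 ≤ θ ^ 2 := by
      rw [mul_pow]
      exact mul_le_of_le_one_left (sq_nonneg _) (pow_le_one₀ hp0.le hp1.le)
    have e4 := mul_le_mul hp1.le e1 (norm_nonneg _) zero_le_one
    linarith
  have h2 : ‖Complex.exp (w * Complex.I) - bernoulliChar p θ‖ ≤ 4 * θ ^ 2 := by
    have e : Complex.exp (w * Complex.I) - bernoulliChar p θ =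
        ((1 - ‖bernoulliChar p θ‖ : ℝ) : ℂ) * Complex.exp (w * Complex.I) := by
      nth_rewrite 1 [← hz]; push_cast; ring
    rw [e, norm_mul, Complex.norm_exp_ofReal_mul_I, mul_one, Complex.norm_real, Real.norm_eq_abs,
      abs_of_nonneg (by linarith [norm_bernoulliChar_le_one hp0 hp1 θ])]
    have e2 := norm_sub_norm_le (Complex.exp ((p * θ : ℝ) * Complex.I)) (bernoulliChar p θ)
    rw [Complex.norm_exp_ofReal_mul_I, norm_sub_rev] at e2
    linarith
  have h3 : ‖Complex.exp (w * Complex.I) - Complex.exp ((p * θ : ℝ) * Complex.I)‖ ≤ 8 * θ ^ 2 := by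
    have := norm_add_le (Complex.exp (w * Complex.I) - bernoulliChar p θ)
      (bernoulliChar p θ - Complex.exp ((p * θ : ℝ) * Complex.I))
    rw [sub_add_sub_cancel] at this
    linarith
  have e : Complex.exp (w * Complex.I) - Complex.exp ((p * θ : ℝ) * Complex.I) =
      Complex.exp ((p * θ : ℝ) * Complex.I) *
        (Complex.exp (Complex.I * ((w - p * θ : ℝ) : ℂ)) - 1) := by
    rw [mul_sub, mul_one, ← Complex.exp_add]
    congr 2
    push_cast; ring
  rw [e, norm_mul, Complex.norm_exp_ofReal_mul_I, one_mul, Complex.norm_exp_I_mul_ofReal_sub_one,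
    Real.norm_eq_abs, abs_mul, abs_two] at h3
  linarith

lemma norm_bernoulliChar_pow_le {p : ℝ} (hp0 : 0 < p) (hp1 : p < 1) (n : ℕ) {θ : ℝ}
    (hθ : |θ| ≤ Real.pi) :
    ‖bernoulliChar p θ‖ ^ n ≤ Real.exp (-(n * (2 * (p * (1 - p)) / Real.pi ^ 2) * θ ^ 2)) := by
  have hq : 0 < p * (1 - p) := mul_pos hp0 (by linarith)
  have h1 : ‖bernoulliChar p θ‖ ≤ Real.exp (-(2 * (p * (1 - p)) / Real.pi ^ 2 * θ ^ 2)) := by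
    apply le_of_sq_le_sq _ (Real.exp_pos _).le
    rw [norm_bernoulliChar_sq, ← Real.exp_nat_mul]
    have h2 := mul_le_mul_of_nonneg_left (two_div_pi_sq_mul_sq_le_one_sub_cos hθ)
      (by linarith : 0 ≤ 2 * (p * (1 - p)))
    have h3 := Real.add_one_le_exp
      ((2 : ℕ) * -(2 * (p * (1 - p)) / Real.pi ^ 2 * θ ^ 2))
    have h4 : ((2 : ℕ) : ℝ) * -(2 * (p * (1 - p)) / Real.pi ^ 2 * θ ^ 2) =
      -(2 * (p * (1 - p)) * (2 / Real.pi ^ 2 * θ ^ 2)) := by push_cast; ring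
    rw [h4] at h3 ⊢
    linarith
  refine (pow_le_pow_left₀ (norm_nonneg _) h1 n).trans_eq ?_
  rw [← Real.exp_nat_mul]
  congr 1
  ring

lemma one_sub_cos_le_of_sub_eq {p : ℝ} (hp0 : 0 < p) (hp1 : p < 1) (k : ℕ) (y : ℤ) {η : ℝ}
    (hη : |k * p - y| ≤ η) (θ : ℝ) :
    1 - Real.cos (k * (bernoulliChar p θ).arg - y * θ) ≤ 64 * k ^ 2 * θ ^ 4 + η ^ 2 * θ ^ 2 := by
  rw [one_sub_cos_eq, show ((k : ℝ) * (bernoulliChar p θ).arg - y * θ) / 2 =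
    k * (((bernoulliChar p θ).arg - p * θ) / 2) + (k * p - y) * θ / 2 by ring, Real.sin_add]
  set u := k * (((bernoulliChar p θ).arg - p * θ) / 2)
  set v := (k * p - y) * θ / 2
  have h1 : |Real.sin u| ≤ k * (4 * θ ^ 2) :=
    (abs_sin_nat_mul_le k _).trans (by gcongr; exact abs_sin_arg_sub_le hp0 hp1 θ)
  have h2 : |Real.sin v| ≤ η * |θ| / 2 := by
    refine Real.abs_sin_le_abs.trans ?_
    rw [abs_div, abs_mul, abs_two]
    gcongr
  have h3 : Real.sin u ^ 2 ≤ (k * (4 * θ ^ 2)) ^ 2 := by rw [← sq_abs]; gcongr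
  have h4 : Real.sin v ^ 2 ≤ (η * |θ| / 2) ^ 2 := by rw [← sq_abs]; gcongr
  have h5 : (η * |θ| / 2) ^ 2 = η ^ 2 * θ ^ 2 / 4 := by
    rw [div_pow, mul_pow, sq_abs]; norm_num
  have h6 : (Real.sin u * Real.cos v) ^ 2 ≤ Real.sin u ^ 2 := by
    rw [mul_pow]; exact mul_le_of_le_one_right (sq_nonneg _) (Real.cos_sq_le_one _)
  have h7 : (Real.cos u * Real.sin v) ^ 2 ≤ Real.sin v ^ 2 := by
    rw [mul_pow]; exact mul_le_of_le_one_left (sq_nonneg _) (Real.cos_sq_le_one _)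
  rw [h5] at h4
  nlinarith [sq_nonneg (Real.sin u * Real.cos v - Real.cos u * Real.sin v)]

lemma mul_exp_neg_le {b A B : ℝ} (hb : 0 < b) (hA : 0 ≤ A) (hB : 0 ≤ B) (θ : ℝ) :
    (A * θ ^ 4 + B * θ ^ 2) * Real.exp (-(2 * b * θ ^ 2)) ≤
      (2 * A / b ^ 2 + B / b) * Real.exp (-b * θ ^ 2) := by
  have hx : 0 ≤ b * θ ^ 2 := by positivity
  have h := Real.quadratic_le_exp_of_nonneg hx
  have h1 : θ ^ 2 ≤ Real.exp (b * θ ^ 2) / b := by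
    rw [le_div_iff₀ hb]; nlinarith [sq_nonneg (b * θ ^ 2)]
  have h2 : θ ^ 4 ≤ 2 * Real.exp (b * θ ^ 2) / b ^ 2 := by
    rw [le_div_iff₀ (by positivity)]; nlinarith
  have h3 : Real.exp (b * θ ^ 2) * Real.exp (-(2 * b * θ ^ 2)) = Real.exp (-b * θ ^ 2) := by
    rw [← Real.exp_add]; congr 1; ring
  calc _ ≤ (A * (2 * Real.exp (b * θ ^ 2) / b ^ 2) + B * (Real.exp (b * θ ^ 2) / b)) *
        Real.exp (-(2 * b * θ ^ 2)) := by gcongr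
    _ = (2 * A / b ^ 2 + B / b) * (Real.exp (b * θ ^ 2) * Real.exp (-(2 * b * θ ^ 2))) := by
      ring
    _ = _ := by rw [h3]

lemma integral_inversionDeficit_le {p : ℝ} (hp0 : 0 < p) (hp1 : p < 1) {ℓ m k : ℕ}
    (hk : (ℓ : ℝ) - m = k) (hpos : 0 < ℓ + m) (y : ℤ) {η b : ℝ} (hη : |k * p - y| ≤ η)
    (hb : b = ((ℓ : ℝ) + m) * (p * (1 - p) / Real.pi ^ 2)) :
    ∫ θ in (-Real.pi)..Real.pi, inversionDeficit ℓ m p y θ ≤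
      (128 * k ^ 2 / b ^ 2 + η ^ 2 / b) * √(Real.pi / b) := by
  have hpi := Real.pi_pos
  have hn : (0 : ℝ) < (ℓ : ℝ) + m := by exact_mod_cast hpos
  have hq : 0 < p * (1 - p) := mul_pos hp0 (by linarith)
  have hb0 : 0 < b := by rw [hb]; positivity
  have hle : ∀ θ ∈ Set.Icc (-Real.pi) Real.pi, inversionDeficit ℓ m p y θ ≤
      (128 * k ^ 2 / b ^ 2 + η ^ 2 / b) * Real.exp (-b * θ ^ 2) := by
    intro θ hθ
    rw [inversionDeficit_eq, hk]
    have h1 := norm_bernoulliChar_pow_le hp0 hp1 (ℓ + m) (abs_le.2 hθ)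
    have h2 := one_sub_cos_le_of_sub_eq hp0 hp1 k y hη θ
    have h3 := mul_exp_neg_le hb0 (A := 64 * k ^ 2) (by positivity) (sq_nonneg η) θ
    have h4 : ((ℓ + m : ℕ) : ℝ) * (2 * (p * (1 - p)) / Real.pi ^ 2) * θ ^ 2 =
      2 * b * θ ^ 2 := by rw [hb]; push_cast; ring
    rw [h4] at h1
    calc _ ≤ Real.exp (-(2 * b * θ ^ 2)) * (64 * k ^ 2 * θ ^ 4 + η ^ 2 * θ ^ 2) :=
          mul_le_mul h1 h2 (sub_nonneg.2 (Real.cos_le_one _)) (Real.exp_pos _).le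
      _ ≤ (2 * (64 * k ^ 2) / b ^ 2 + η ^ 2 / b) * Real.exp (-b * θ ^ 2) := by
          rw [mul_comm]; exact h3
      _ = _ := by ring
  refine (intervalIntegral.integral_mono_on (by linarith)
    ((continuous_inversionDeficit ℓ m p y).intervalIntegrable _ _)
    (Continuous.intervalIntegrable (by fun_prop) _ _) hle).trans ?_
  rw [intervalIntegral.integral_const_mul]
  gcongr
  rw [← integral_gaussian, intervalIntegral.integral_of_le (by linarith)]
  exact setIntegral_le_integral (integrable_exp_neg_mul_sq hb0)
    (Filter.Eventually.of_forall fun θ => (Real.exp_pos _).le)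

lemma exists_odd_nat_abs_mul_sub_lt {p : ℝ} (hp : Irrational p) {η : ℝ} (hη : 0 < η) :
    ∃ k : ℕ, Odd k ∧ ∃ y : ℤ, |k * p - y| < η := by
  have hirr : Irrational (2 * p / 1) := by
    rw [div_one]
    exact_mod_cast hp.ratCast_mul (q := 2) two_ne_zero
  obtain ⟨z, hz, hd⟩ := (dense_addSubgroupClosure_pair_iff.2 hirr).exists_dist_lt (-p) hη
  obtain ⟨a, b, rfl⟩ := AddSubgroup.mem_closure_pair.1 hz
  rw [Real.dist_eq, zsmul_eq_mul, zsmul_eq_mul] at hd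
  have hd' : |((2 * a + 1 : ℤ) : ℝ) * p - ((-b : ℤ) : ℝ)| < η := by
    rw [← abs_neg]
    convert hd using 2
    push_cast; ring
  obtain ⟨k, h | h⟩ := Int.eq_nat_or_neg (2 * a + 1)
  · rw [h, Int.cast_natCast] at hd'
    exact ⟨k, by grind, -b, hd'⟩
  · refine ⟨k, by grind, b, ?_⟩
    rw [h, ← abs_neg] at hd'
    convert hd' using 2
    push_cast; ring

/-- for irrational `p` and odd `n`, the optimal number of `+1`
coefficients is `(1/2 + o(1)) n`.  The optimality hypothesis
`∀ ℓ' ≤ n, ∀ y', ∃ y, D ℓ' _ y' ≤ D ℓ _ y` encodes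
`max_y D(ℓ, n-ℓ, p, y) ≥ max_y D(ℓ', n-ℓ', p, y)` (both maxima are attained since
`y ↦ D` has finite support). -/
theorem stmt_13 (p : ℝ) (hpirr : Irrational p) (hp0 : 0 < p) (hp1 : p < 1) :
    ∀ ε : ℝ, 0 < ε → ∃ N : ℕ, ∀ n : ℕ, N ≤ n → Odd n →
      ∀ ℓ : ℕ, ℓ ≤ n →
        (∀ ℓ' : ℕ, ℓ' ≤ n → ∀ y' : ℤ, ∃ y : ℤ,
          D ℓ' (n - ℓ') p y' ≤ D ℓ (n - ℓ) p y) →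
        |(ℓ : ℝ) - (n : ℝ) / 2| ≤ ε * (n : ℝ) := by
  intro ε hε
  have hpi := Real.pi_pos
  have hq : 0 < p * (1 - p) := mul_pos hp0 (by linarith)
  have hne : 0 < |1 - 2 * p| := by
    rw [abs_pos]
    intro h
    exact hpirr ⟨1 / 2, by push_cast; linarith⟩
  obtain ⟨a, ha⟩ : ∃ a, a = p * (1 - p) / Real.pi ^ 2 := ⟨_, rfl⟩
  obtain ⟨c, hc⟩ : ∃ c, c = 8 / Real.pi ^ 3 * (p * (1 - p) * |1 - 2 * p|) := ⟨_, rfl⟩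
  have ha0 : 0 < a := by rw [ha]; positivity
  have hc0 : 0 < c := by rw [hc]; positivity
  set S := √(16 * Real.pi / a) with hS
  have hS0 : 0 < S := by positivity
  set E := ε ^ 2 * (c / Real.pi) ^ 2 / 384 with hE
  have hE0 : 0 < E := by positivity
  set η := √(a * E / (64 * S)) with hη
  have hη0 : 0 < η := by positivity
  have hη2 : η ^ 2 = a * E / (64 * S) := Real.sq_sqrt (by positivity)
  obtain ⟨k, hkodd, y₀, hy₀⟩ := exists_odd_nat_abs_mul_sub_lt hpirr hη0
  obtain ⟨N₁, hN₁⟩ := exists_nat_gt (4096 * k ^ 2 * S / (a ^ 2 * E))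
  refine ⟨max (max 64 k) N₁, fun n hn hodd ℓ hℓ hopt => ?_⟩
  have hn64 : 64 ≤ n := le_trans (by simp) hn
  have hnk : k ≤ n := le_trans (by simp) hn
  have hnN : N₁ ≤ n := le_trans (by simp) hn
  have hnR : (64 : ℝ) ≤ n := by exact_mod_cast hn64
  by_contra! hcon
  obtain ⟨ℓ', hℓ'⟩ : ∃ ℓ', n + k = 2 * ℓ' := by
    obtain ⟨t, ht⟩ := hodd.add_odd hkodd
    exact ⟨t, by omega⟩
  have hℓ'n : ℓ' ≤ n := by omega
  obtain ⟨y, hy⟩ := hopt ℓ' hℓ'n y₀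
  have hcast : ((n - ℓ' : ℕ) : ℝ) = n - ℓ' := Nat.cast_sub hℓ'n
  have hcast2 : ((n - ℓ : ℕ) : ℝ) = n - ℓ := Nat.cast_sub hℓ
  have hk' : (ℓ' : ℝ) - ((n - ℓ' : ℕ) : ℝ) = k := by
    have : (n : ℝ) + k = 2 * ℓ' := by exact_mod_cast hℓ'
    rw [hcast]; linarith
  set s := √(n : ℝ) with hs
  have hs2 : s ^ 2 = n := Real.sq_sqrt (by positivity)
  have hs8 : 8 ≤ s := Real.le_sqrt_of_sq_le (by linarith)
  set h := 1 / (4 * s) with hh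
  have hs0 : 0 < s := by linarith
  have hh0 : 0 < h := by positivity
  have hh1 : h ≤ 1 / 32 := by
    rw [hh]; apply one_div_le_one_div_of_le <;> linarith
  have hnh : 16 * (n : ℝ) * h ^ 2 = 1 := by
    rw [← hs2, hh]; field_simp; norm_num
  have hlow := le_integral_inversionDeficit hp0 hp1 ℓ (n - ℓ) y hh0 hh1
    (by rw [hcast2, add_sub_cancel]; exact hnh)
  have hup := integral_inversionDeficit_le hp0 hp1 hk' (by omega) y₀ hy₀.le
    (b := n * a) (by rw [hcast, add_sub_cancel, ha])
  have hcmp : ∫ θ in (-Real.pi)..Real.pi, inversionDeficit ℓ (n - ℓ) p y θ ≤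
      ∫ θ in (-Real.pi)..Real.pi, inversionDeficit ℓ' (n - ℓ') p y₀ θ := by
    rw [integral_inversionDeficit, integral_inversionDeficit, Nat.add_sub_cancel' hℓ,
      Nat.add_sub_cancel' hℓ'n]
    have := mul_le_mul_of_nonneg_left hy (by positivity : 0 ≤ 2 * Real.pi)
    linarith
  rw [← hc] at hlow
  have hn0 : (0 : ℝ) < n := by linarith
  have hna : 1 / ((n : ℝ) * a) = 16 * h ^ 2 / a := by
    field_simp
    linarith
  have hsqrt : √(Real.pi / (n * a)) = h * S := by
    rw [hS, ← Real.sqrt_sq hh0.le, ← Real.sqrt_mul (by positivity)]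
    congr 1
    calc Real.pi / (n * a) = Real.pi * (1 / (n * a)) := by ring
      _ = _ := by rw [hna]; ring
  have hup2 : (128 * k ^ 2 / (n * a) ^ 2 + η ^ 2 / (n * a)) * √(Real.pi / (n * a)) =
      h ^ 3 * ((2048 * k ^ 2 * S / a ^ 2) / n + 16 * η ^ 2 * S / a) := by
    rw [hsqrt]
    calc _ = (128 * k ^ 2 / (n * a) * (1 / (n * a)) + η ^ 2 * (1 / (n * a))) * (h * S) := by
          field_simp
      _ = _ := by rw [hna]; field_simp; ring
  have hterm1 : (2048 * k ^ 2 * S / a ^ 2) / n < E / 2 := by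
    have h1 : 4096 * k ^ 2 * S / (a ^ 2 * E) < n :=
      lt_of_lt_of_le hN₁ (by exact_mod_cast hnN)
    rw [div_lt_iff₀ (by positivity)] at h1
    rw [div_div, div_lt_iff₀ (by positivity)]
    have h2 : E / 2 * (a ^ 2 * n) = n * (a ^ 2 * E) / 2 := by ring
    linarith
  have hterm2 : 16 * η ^ 2 * S / a = E / 4 := by
    rw [hη2]; field_simp; norm_num
  have hK : 4 * ε ^ 2 * n ^ 2 ≤ ((ℓ : ℝ) - (n - ℓ : ℕ)) ^ 2 := by
    rw [hcast2]
    have h1 : (ε * n) ^ 2 ≤ |(ℓ : ℝ) - n / 2| ^ 2 := by gcongr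
    rw [sq_abs] at h1
    calc _ = 4 * (ε * n) ^ 2 := by ring
      _ ≤ 4 * ((ℓ : ℝ) - n / 2) ^ 2 := by linarith
      _ = _ := by ring
  have hlow2 : 9 / 2 * (h ^ 3 * E) ≤
      h * (3 / 4 * (((ℓ : ℝ) - (n - ℓ : ℕ)) * (c * h ^ 3) / Real.pi) ^ 2) := by
    calc 9 / 2 * (h ^ 3 * E) = 3 / 4 * (h ^ 3 * (c / Real.pi) ^ 2) * (4 * ε ^ 2) *
          (1 / 256) := by rw [hE]; ring
      _ = 3 / 4 * (h ^ 3 * (c / Real.pi) ^ 2) * (4 * ε ^ 2) *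
          ((16 * (n : ℝ) * h ^ 2) ^ 2 / 256) := by rw [hnh]; norm_num
      _ = 3 / 4 * (h ^ 7 * (c / Real.pi) ^ 2) * (4 * ε ^ 2 * n ^ 2) := by ring
      _ ≤ 3 / 4 * (h ^ 7 * (c / Real.pi) ^ 2) * ((ℓ : ℝ) - (n - ℓ : ℕ)) ^ 2 := by gcongr
      _ = _ := by ring
  rw [hup2] at hup
  have hh3 : 0 < h ^ 3 := by positivity
  have hfin : h ^ 3 * E ≤ h ^ 3 * ((2048 * k ^ 2 * S / a ^ 2) / n + 16 * η ^ 2 * S / a) := by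
    linarith
  have := le_of_mul_le_mul_left hfin hh3
  linarith
end

section
/- Fix a real p with 0 < p < 1 and p ≠ 1/2. Then there exists N such that for every integer n ≥ N, every integer ℓ with 0 ≤ ℓ ≤ n, and every integer x satisfying D(ℓ, n−ℓ, p, x) ≥ D(ℓ, n−ℓ, p, x') for all integers x' (i.e. x maximizes the point probability of Bin(ℓ,p) − Bin(n−ℓ,p)), one has |x − (2ℓ − n)·p| ≤ n^{1/100}. -/
open Finset

/-- The mean of `φ` under the binomial distribution with parameters `n` and `p`. -/
noncomputable def binomMean (n : ℕ) (p : ℝ) (φ : ℕ → ℝ) : ℝ :=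
  ∑ k ∈ Finset.range (n + 1), (n.choose k : ℝ) * p ^ k * (1 - p) ^ (n - k) * φ k

theorem binomMean_succ (n : ℕ) (p : ℝ) (φ : ℕ → ℝ) :
    binomMean (n + 1) p φ =
      p * binomMean n p (fun k => φ (k + 1)) + (1 - p) * binomMean n p φ := by
  have h : (1 - p) * binomMean n p φ =
      ∑ k ∈ Finset.range (n + 2), (n.choose k : ℝ) * p ^ k * (1 - p) ^ (n + 1 - k) * φ k := by
    rw [Finset.sum_range_succ, Nat.choose_succ_self, binomMean, Finset.mul_sum]
    simp only [Nat.cast_zero, zero_mul, add_zero]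
    refine Finset.sum_congr rfl fun k hk => ?_
    rw [Nat.succ_sub (Nat.lt_succ_iff.mp (Finset.mem_range.mp hk)), pow_succ]
    ring
  rw [h, Finset.sum_range_succ', binomMean, binomMean, Finset.mul_sum, Finset.sum_range_succ',
    ← add_assoc, ← Finset.sum_add_distrib]
  congr 1
  · refine Finset.sum_congr rfl fun k _ => ?_
    rw [Nat.choose_succ_succ, Nat.add_sub_add_right]
    push_cast
    ring
  · simp

theorem binomMean_linear (n : ℕ) (p a b : ℝ) (φ ψ : ℕ → ℝ) :
    binomMean n p (fun k => a * φ k + b * ψ k) = a * binomMean n p φ + b * binomMean n p ψ := by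
  simp only [binomMean, Finset.mul_sum, ← Finset.sum_add_distrib]
  exact Finset.sum_congr rfl fun k _ => by ring

theorem D_eq_binomMean (ℓ m : ℕ) (p : ℝ) (y : ℤ) :
    D ℓ m p y = binomMean ℓ p fun k => binomMean m p fun j =>
      if (k : ℤ) - (j : ℤ) = y then 1 else 0 := by
  simp only [D, binomMean, Finset.mul_sum]
  refine Finset.sum_congr rfl fun k _ => Finset.sum_congr rfl fun j _ => ?_
  split_ifs
  · rw [pow_add, pow_add]
    ring
  · simp

theorem D_succ_left (ℓ m : ℕ) (p : ℝ) (y : ℤ) :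
    D (ℓ + 1) m p y = p * D ℓ m p (y - 1) + (1 - p) * D ℓ m p y := by
  have h (k j : ℕ) : ((k + 1 : ℕ) : ℤ) - j = y ↔ (k : ℤ) - j = y - 1 := by omega
  simp only [D_eq_binomMean, binomMean_succ ℓ, h]

theorem D_succ_right (ℓ m : ℕ) (p : ℝ) (y : ℤ) :
    D ℓ (m + 1) p y = p * D ℓ m p (y + 1) + (1 - p) * D ℓ m p y := by
  have h (k j : ℕ) : (k : ℤ) - (j + 1 : ℕ) = y ↔ (k : ℤ) - j = y + 1 := by omega
  simp only [D_eq_binomMean, binomMean_succ m, h, binomMean_linear ℓ]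

theorem D_zero_zero (p : ℝ) (y : ℤ) : D 0 0 p y = if y = 0 then 1 else 0 := by
  simp [D, eq_comm]

theorem D_nonneg (ℓ m : ℕ) {p : ℝ} (hp0 : 0 ≤ p) (hp1 : p ≤ 1) (y : ℤ) : 0 ≤ D ℓ m p y := by
  have := sub_nonneg.mpr hp1
  unfold D
  positivity

theorem D_pos (ℓ m : ℕ) {p : ℝ} (hp0 : 0 < p) (hp1 : p < 1) {y : ℤ} (hy₁ : -(m : ℤ) ≤ y)
    (hy₂ : y ≤ ℓ) : 0 < D ℓ m p y := by
  have hq := sub_pos.mpr hp1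
  have hD (ℓ m : ℕ) (y : ℤ) := D_nonneg ℓ m hp0.le hp1.le y
  induction ℓ generalizing y with
  | zero =>
    induction m generalizing y with
    | zero =>
      obtain rfl : y = 0 := by omega
      simp [D_zero_zero]
    | succ m ih =>
      rw [D_succ_right]
      by_cases h : y = -(m + 1 : ℕ)
      · exact add_pos_of_pos_of_nonneg (mul_pos hp0 (ih (by omega) (by omega)))
          (mul_nonneg hq.le (hD _ _ _))
      · exact add_pos_of_nonneg_of_pos (mul_nonneg hp0.le (hD _ _ _))
          (mul_pos hq (ih (by omega) (by omega)))
  | succ ℓ ih =>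
    rw [D_succ_left]
    by_cases h : y = (ℓ + 1 : ℕ)
    · exact add_pos_of_pos_of_nonneg (mul_pos hp0 (ih (by omega) (by omega)))
        (mul_nonneg hq.le (hD _ _ _))
    · exact add_pos_of_nonneg_of_pos (mul_nonneg hp0.le (hD _ _ _))
        (mul_pos hq (ih (by omega) (by omega)))

theorem D_eq_zero (ℓ m : ℕ) (p : ℝ) {y : ℤ} (hy : y < -(m : ℤ) ∨ ℓ < y) : D ℓ m p y = 0 := by
  refine Finset.sum_eq_zero fun k hk => Finset.sum_eq_zero fun j hj => if_neg ?_
  rw [Finset.mem_range] at hk hj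
  omega

/-- Nonnegative log-concave sequences without internal zeros. -/
structure IsLogConcaveSeq (g : ℤ → ℝ) : Prop where
  nonneg : ∀ a, 0 ≤ g a
  mul_le : ∀ a b, a ≤ b → g (a - 1) * g (b + 1) ≤ g a * g b

namespace IsLogConcaveSeq

variable {g : ℤ → ℝ}

theorem shift (hg : IsLogConcaveSeq g) (c : ℤ) : IsLogConcaveSeq fun y => g (y + c) where
  nonneg a := hg.nonneg _
  mul_le a b hab := by
    have := hg.mul_le (a + c) (b + c) (by omega)
    rwa [show a + c - 1 = a - 1 + c by ring, show b + c + 1 = b + 1 + c by ring] at this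

theorem convolve (hg : IsLogConcaveSeq g) {s t : ℝ} (hs : 0 ≤ s) (ht : 0 ≤ t) :
    IsLogConcaveSeq fun y => s * g (y - 1) + t * g y where
  nonneg a := add_nonneg (mul_nonneg hs (hg.nonneg _)) (mul_nonneg ht (hg.nonneg _))
  mul_le a b hab := by
    have h₁ := hg.mul_le (a - 1) (b - 1) (by omega)
    have h₂ := hg.mul_le a b hab
    have h₃ : g (a - 1 - 1) * g (b + 1) ≤ g a * g (b - 1) := by
      rcases hab.eq_or_lt with rfl | hab
      · linarith [hg.mul_le (a - 1) a (by omega), mul_comm (g a) (g (a - 1))]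
      · have h := hg.mul_le a (b - 1) (by omega)
        have h' := hg.mul_le (a - 1) b (by omega)
        rw [sub_add_cancel] at h
        exact h'.trans h
    rw [sub_add_cancel] at h₁
    simp only [add_sub_cancel_right]
    nlinarith [mul_le_mul_of_nonneg_left h₁ (mul_nonneg hs hs),
      mul_le_mul_of_nonneg_left h₂ (mul_nonneg ht ht),
      mul_le_mul_of_nonneg_left h₃ (mul_nonneg hs ht)]

/-- Once a log-concave sequence has decreased, it does not increase any more. -/
theorem le_of_lt (hg : IsLogConcaveSeq g) {a : ℤ} (h : g a < g (a - 1)) : g (a + 1) ≤ g a := by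
  by_contra! h'
  have h₁ := hg.mul_le a a le_rfl
  have h₂ := hg.nonneg a
  nlinarith

/-- If averaging with a shift does not decrease at `a`, neither did the sequence before `a`. -/
theorem le_of_convolve_le (hg : IsLogConcaveSeq g) {s t : ℝ} (hs : 0 < s) (ht : 0 < t) {a : ℤ}
    (h : s * g (a - 1) + t * g a ≤ s * g a + t * g (a + 1)) : g (a - 1) ≤ g a := by
  by_contra! h'
  nlinarith [hg.le_of_lt h']

/-- If averaging with a shift does not increase at `a`, neither does the sequence after `a`. -/
theorem le_of_le_convolve (hg : IsLogConcaveSeq g) {s t : ℝ} (hs : 0 < s) (ht : 0 < t) {a : ℤ}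
    (h : s * g a + t * g (a + 1) ≤ s * g (a - 1) + t * g a) : g (a + 1) ≤ g a := by
  by_contra! h'
  have : g (a - 1) ≤ g a := by
    by_contra! h''
    exact absurd (hg.le_of_lt h'') h'.not_ge
  nlinarith

end IsLogConcaveSeq

theorem isLogConcaveSeq_D (ℓ m : ℕ) {p : ℝ} (hp0 : 0 ≤ p) (hp1 : p ≤ 1) :
    IsLogConcaveSeq (D ℓ m p) := by
  have hq := sub_nonneg.mpr hp1
  induction ℓ with
  | zero =>
    induction m with
    | zero =>
      refine ⟨D_nonneg 0 0 hp0 hp1, fun a b hab => ?_⟩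
      simp only [D_zero_zero]
      split_ifs <;> first | omega | norm_num
    | succ m ih =>
      convert (ih.shift 1).convolve hq hp0 using 2 with y
      rw [D_succ_right, sub_add_cancel]
      ring
  | succ ℓ ih =>
    convert ih.convolve hp0 hq using 2 with y
    exact D_succ_left ℓ m p y

/-- Stein's identity, before centering. -/
theorem mul_D_eq (ℓ m : ℕ) (p : ℝ) (y : ℤ) :
    y * D ℓ m p y = ℓ * p * D (ℓ - 1) m p (y - 1) - m * p * D ℓ (m - 1) p (y + 1) := by
  induction ℓ generalizing y with
  | zero =>
    induction m generalizing y with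
    | zero => simp [D_zero_zero]
    | succ m ih =>
      have h₁ := ih (y + 1)
      have h₂ := ih y
      rw [D_succ_right, Nat.add_sub_cancel]
      rcases m with _ | m
      · push_cast at h₁ h₂ ⊢
        linear_combination p * h₁ + (1 - p) * h₂
      · rw [Nat.add_sub_cancel] at h₁ h₂
        have h₃ := D_succ_right 0 m p (y + 1)
        push_cast at h₁ h₂ ⊢
        linear_combination p * h₁ + (1 - p) * h₂ + (m + 1) * p * h₃
  | succ ℓ ih =>
    have h₁ := ih (y - 1)
    have h₂ := ih y
    have h₃ := D_succ_left ℓ (m - 1) p (y + 1)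
    rw [D_succ_left, Nat.add_sub_cancel]
    rw [sub_add_cancel] at h₁
    rw [add_sub_cancel_right] at h₃
    rcases ℓ with _ | ℓ
    · push_cast at h₁ h₂ ⊢
      linear_combination p * h₁ + (1 - p) * h₂ + m * p * h₃
    · rw [Nat.add_sub_cancel] at h₁ h₂
      have h₄ := D_succ_left ℓ m p (y - 1)
      push_cast at h₁ h₂ ⊢
      linear_combination p * h₁ + (1 - p) * h₂ + m * p * h₃ - (ℓ + 1) * p * h₄

/-- Stein's identity for the difference of two independent binomials. -/
theorem sub_mean_mul_D (ℓ m : ℕ) (p : ℝ) (y : ℤ) :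
    (y - (ℓ - m) * p) * D ℓ m p y =
      p * (1 - p) * (ℓ * (D (ℓ - 1) m p (y - 1) - D (ℓ - 1) m p y) +
        m * (D ℓ (m - 1) p y - D ℓ (m - 1) p (y + 1))) := by
  have h := mul_D_eq ℓ m p y
  have hℓ : (ℓ : ℝ) * D ℓ m p y =
      ℓ * (p * D (ℓ - 1) m p (y - 1) + (1 - p) * D (ℓ - 1) m p y) := by
    rcases ℓ with _ | ℓ
    · simp
    · rw [D_succ_left, Nat.add_sub_cancel]
  have hm : (m : ℝ) * D ℓ m p y =
      m * (p * D ℓ (m - 1) p (y + 1) + (1 - p) * D ℓ (m - 1) p y) := by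
    rcases m with _ | m
    · simp
    · rw [D_succ_right, Nat.add_sub_cancel]
  linear_combination h - p * hℓ + p * hm

/-- Where `D` does not decrease towards `y + 1`, the point `y` is at most the mean. -/
theorem le_mean_of_D_le (ℓ m : ℕ) {p : ℝ} (hp0 : 0 < p) (hp1 : p < 1) {y : ℤ}
    (hy : 0 < D ℓ m p y) (h : D ℓ m p y ≤ D ℓ m p (y + 1)) : (y : ℝ) ≤ (ℓ - m) * p := by
  have hq := sub_pos.mpr hp1
  have hℓ : (ℓ : ℝ) * (D (ℓ - 1) m p (y - 1) - D (ℓ - 1) m p y) ≤ 0 := by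
    rcases ℓ with _ | ℓ
    · simp
    · rw [D_succ_left, D_succ_left, add_sub_cancel_right] at h
      exact mul_nonpos_of_nonneg_of_nonpos (Nat.cast_nonneg _) (sub_nonpos.mpr
        ((isLogConcaveSeq_D ℓ m hp0.le hp1.le).le_of_convolve_le hp0 hq h))
  have hm : (m : ℝ) * (D ℓ (m - 1) p y - D ℓ (m - 1) p (y + 1)) ≤ 0 := by
    rcases m with _ | m
    · simp
    · rw [D_succ_right, D_succ_right] at h
      have := (isLogConcaveSeq_D ℓ m hp0.le hp1.le).le_of_convolve_le (a := y + 1) hq hp0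
        (by rw [add_sub_cancel_right]; linarith)
      rw [add_sub_cancel_right] at this
      exact mul_nonpos_of_nonneg_of_nonpos (Nat.cast_nonneg _) (sub_nonpos.mpr this)
  have key := sub_mean_mul_D ℓ m p y
  by_contra! hlt
  have := mul_pos (sub_pos.mpr hlt) hy
  nlinarith [mul_pos hp0 hq]

/-- Where `D` does not increase from `y - 1`, the point `y` is at least the mean. -/
theorem mean_le_of_D_le (ℓ m : ℕ) {p : ℝ} (hp0 : 0 < p) (hp1 : p < 1) {y : ℤ}
    (hy : 0 < D ℓ m p y) (h : D ℓ m p y ≤ D ℓ m p (y - 1)) : (ℓ - m) * p ≤ (y : ℝ) := by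
  have hq := sub_pos.mpr hp1
  have hℓ : 0 ≤ (ℓ : ℝ) * (D (ℓ - 1) m p (y - 1) - D (ℓ - 1) m p y) := by
    rcases ℓ with _ | ℓ
    · simp
    · rw [D_succ_left, D_succ_left] at h
      have := (isLogConcaveSeq_D ℓ m hp0.le hp1.le).le_of_le_convolve (a := y - 1) hp0 hq
        (by rwa [sub_add_cancel])
      rw [sub_add_cancel] at this
      exact mul_nonneg (Nat.cast_nonneg _) (sub_nonneg.mpr this)
  have hm : 0 ≤ (m : ℝ) * (D ℓ (m - 1) p y - D ℓ (m - 1) p (y + 1)) := by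
    rcases m with _ | m
    · simp
    · rw [D_succ_right, D_succ_right, sub_add_cancel] at h
      exact mul_nonneg (Nat.cast_nonneg _) (sub_nonneg.mpr
        ((isLogConcaveSeq_D ℓ m hp0.le hp1.le).le_of_le_convolve (a := y) hq hp0
          (by linarith)))
  have key := sub_mean_mul_D ℓ m p y
  by_contra! hlt
  have := mul_neg_of_neg_of_pos (sub_neg.mpr hlt) hy
  nlinarith [mul_pos hp0 hq]

/-- Darroch's rule: a mode of the difference of two binomials is within `1` of the mean. -/
theorem abs_mode_sub_mean_le_one (ℓ m : ℕ) {p : ℝ} (hp0 : 0 < p) (hp1 : p < 1) {x : ℤ}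
    (hx : ∀ x', D ℓ m p x' ≤ D ℓ m p x) : |(x : ℝ) - (ℓ - m) * p| ≤ 1 := by
  have hpos : 0 < D ℓ m p x := (D_pos ℓ m hp0 hp1 (y := 0) (by omega) (by omega)).trans_le (hx 0)
  obtain ⟨hx₁, hx₂⟩ : -(m : ℤ) ≤ x ∧ x ≤ ℓ := by
    by_contra hc
    exact hpos.ne' (D_eq_zero ℓ m p (by omega))
  have hℓ : (0 : ℝ) ≤ ℓ := Nat.cast_nonneg _
  have hm : (0 : ℝ) ≤ m := Nat.cast_nonneg _
  rw [abs_le]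
  constructor
  · by_cases h : x = ℓ
    · have : (x : ℝ) = ℓ := by exact_mod_cast h
      nlinarith
    · have := mean_le_of_D_le ℓ m hp0 hp1 (y := x + 1)
        (D_pos ℓ m hp0 hp1 (by omega) (by omega)) (by rw [add_sub_cancel_right]; exact hx _)
      push_cast at this
      linarith
  · by_cases h : x = -m
    · have : (x : ℝ) = -m := by exact_mod_cast h
      nlinarith
    · have := le_mean_of_D_le ℓ m hp0 hp1 (y := x - 1)
        (D_pos ℓ m hp0 hp1 (by omega) (by omega)) (by rw [sub_add_cancel]; exact hx _)
      push_cast at this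
      linarith

/-- for fixed `p ∉ {0, 1/2, 1}` and sufficiently large `n`, any `x`
maximizing the point probability of `Bin(ℓ,p) - Bin(n-ℓ,p)` satisfies
`|x - (2ℓ - n)p| ≤ n^(1/100)`. -/
theorem stmt_16 (p : ℝ) (hp0 : 0 < p) (hp1 : p < 1) (hp2 : p ≠ 1 / 2) :
    ∃ N : ℕ, ∀ n : ℕ, N ≤ n → ∀ ℓ : ℕ, ℓ ≤ n → ∀ x : ℤ,
      (∀ x' : ℤ, D ℓ (n - ℓ) p x' ≤ D ℓ (n - ℓ) p x) →
      |(x : ℝ) - (2 * (ℓ : ℝ) - (n : ℝ)) * p| ≤ (n : ℝ) ^ ((1 : ℝ) / 100) := by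
  refine ⟨1, fun n hn ℓ hℓ x hx => ?_⟩
  have h := abs_mode_sub_mean_le_one ℓ (n - ℓ) hp0 hp1 hx
  rw [Nat.cast_sub hℓ] at h
  calc |(x : ℝ) - (2 * (ℓ : ℝ) - (n : ℝ)) * p| = |(x : ℝ) - (ℓ - (n - ℓ)) * p| := by
        congr 1
        ring
    _ ≤ 1 := h
    _ ≤ (n : ℝ) ^ ((1 : ℝ) / 100) :=
        Real.one_le_rpow (by exact_mod_cast hn) (by norm_num)
end

section
/- Fix a nonnegative integer i, and let γ : {0,…,i} × ℝ → ℝ be an admissible function whose support has size exactly i + 1. Then γ is pure: there exist reals r_0 < r_1 < … < r_i such that γ(k, r) = 1 if r = r_k and γ(k, r) = 0 otherwise. -/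
open Finset

/-- A function `γ : {0,…,i} × ℝ → ℝ` (encoded as `ℕ → ℝ → ℝ`, only values at
`k ≤ i` are relevant) is admissible if it has finite support, is nonnegative,
each row sums to 1, and satisfies the interleaving inequality (Property 3). -/
def Admissible (i : ℕ) (γ : ℕ → ℝ → ℝ) : Prop :=
  {pr : ℕ × ℝ | pr.1 ≤ i ∧ γ pr.1 pr.2 ≠ 0}.Finite ∧
  (∀ k, k ≤ i → ∀ r, 0 ≤ γ k r) ∧
  (∀ k, k ≤ i → ∑ᶠ r, γ k r = 1) ∧
  (∀ k, k < i → ∀ r : ℝ,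
    (∑ᶠ r' ∈ {r' : ℝ | r' ≤ r}, γ (k + 1) r') +
      (∑ᶠ r' ∈ {r' : ℝ | r ≤ r'}, γ k r') ≤ 1)

/-- A function `ζ : {0,…,i} × ℝ → ℝ` is pure if there are reals
`r_0 < r_1 < … < r_i` with `ζ k r = 1` if `r = r_k` and `0` otherwise. -/
def IsPure (i : ℕ) (ζ : ℕ → ℝ → ℝ) : Prop :=
  ∃ rs : ℕ → ℝ, (∀ k, k < i → rs k < rs (k + 1)) ∧
    ∀ k, k ≤ i → ∀ r, ζ k r = if r = rs k then 1 else 0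

/-- The sum of `f` over a set containing the only point `a` where `f` may be nonzero is `f a`. -/
theorem finsum_mem_eq_of_forall_ne_eq_zero {α M : Type*} [AddCommMonoid M]
    {f : α → M} {a : α} {s : Set α} (ha : a ∈ s) (hf : ∀ r, r ≠ a → f r = 0) : ∑ᶠ r ∈ s, f r = f a := by
  rw [finsum_eq_single _ a fun r hr => by simp [hf r hr]]
  simp [ha]

/-- an admissible function whose support has size exactly `i + 1`
is pure. -/
theorem stmt_17 (i : ℕ) (γ : ℕ → ℝ → ℝ) (hγ : Admissible i γ)
    (hsupp : {pr : ℕ × ℝ | pr.1 ≤ i ∧ γ pr.1 pr.2 ≠ 0}.ncard = i + 1) :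
    IsPure i γ := by
  obtain ⟨hfin, -, hsum, hinter⟩ := hγ
  have hex : ∀ k, ∃ r, k ≤ i → γ k r ≠ 0 := by
    intro k
    by_contra! h
    have h1 := hsum k (h 0).1
    simp [fun r => (h r).2] at h1
  choose f hf using hex
  have hcard : ((fun k => (k, f k)) '' Set.Iic i).ncard = i + 1 := by
    rw [Set.ncard_image_of_injective _ fun a b h => congrArg Prod.fst h,
      ← Finset.coe_Iic, Set.ncard_coe_finset, Nat.card_Iic]
  have hsupp_eq : (fun k => (k, f k)) '' Set.Iic i =
      {pr : ℕ × ℝ | pr.1 ≤ i ∧ γ pr.1 pr.2 ≠ 0} := by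
    refine Set.eq_of_subset_of_ncard_le ?_ (by rw [hsupp, hcard]) hfin
    rintro _ ⟨k, hk, rfl⟩
    exact ⟨hk, hf k hk⟩
  have hzero : ∀ k, k ≤ i → ∀ r, r ≠ f k → γ k r = 0 := by
    intro k hk r hr
    by_contra h
    have hmem : (k, r) ∈ (fun k => (k, f k)) '' Set.Iic i := hsupp_eq ▸ ⟨hk, h⟩
    obtain ⟨j, -, hj⟩ := hmem
    obtain ⟨rfl, rfl⟩ := Prod.mk.inj hj
    exact hr rfl
  have hone : ∀ k, k ≤ i → γ k (f k) = 1 := fun k hk => by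
    rw [← hsum k hk, finsum_eq_single _ (f k) (hzero k hk)]
  refine ⟨f, fun k hk => ?_, fun k hk r => ?_⟩
  · by_contra! h
    have h1 := hinter k hk (f (k + 1))
    rw [finsum_mem_eq_of_forall_ne_eq_zero (s := {r | r ≤ f (k + 1)}) (by simp)
        (hzero (k + 1) hk),
      finsum_mem_eq_of_forall_ne_eq_zero (s := {r | f (k + 1) ≤ r}) (by simpa using h)
        (hzero k hk.le),
      hone _ hk, hone _ hk.le] at h1
    norm_num at h1
  · split_ifs with h
    · rw [h, hone k hk]
    · exact hzero k hk r h
end
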